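/- arXiv:2601.06492 — 3 statements merged into one kernel-verified Lean document; each statement's English description precedes it below -/
import Mathlib

section
/- Let α ∈ [1/2, 1). For all p, q ∈ Δ_n, writing A_p := Σ_{k=1}^n p[k] W(k)^α and A_q := Σ_{k=1}^n q[k] W(k)^α, one has ‖A_p^{(1−α)/α} − A_q^{(1−α)/α}‖_{1/(1−α)} ≤ (Σ_{k=1}^n |p[k] − q[k]|)^{(1−α)/α}, where ‖·‖_{1/(1−α)} is the Schatten norm of order 1/(1−α). -/
open Matrix
open scoped ComplexOrder

/-- Matrix power of a Hermitian matrix, defined by applying `t ↦ t ^ r` (real `rpow`)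
to the eigenvalues in a spectral decomposition. Returns `0` on non-Hermitian input. -/
noncomputable def matRpow {d : ℕ} (A : Matrix (Fin d) (Fin d) ℂ) (r : ℝ) :
    Matrix (Fin d) (Fin d) ℂ :=
  if hA : A.IsHermitian then
    (hA.eigenvectorUnitary : Matrix (Fin d) (Fin d) ℂ) *
      Matrix.diagonal (fun i => ((hA.eigenvalues i ^ r : ℝ) : ℂ)) *
      (star hA.eigenvectorUnitary : Matrix (Fin d) (Fin d) ℂ)
  else 0

/-- Schatten norm of order `s`: `‖X‖ₛ = (Tr[|X|^s])^{1/s}` with `|X| = (X* X)^{1/2}`. -/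
noncomputable def schattenNorm {d : ℕ} (s : ℝ) (X : Matrix (Fin d) (Fin d) ℂ) : ℝ :=
  ((matRpow (matRpow (Xᴴ * X) (1 / 2)) s).trace).re ^ (1 / s)

open scoped MatrixOrder Matrix.Norms.L2Operator

section Helpers

variable {d : ℕ}

/-- Spectral form `U diag(a) U*`. -/
noncomputable def cj (U : unitaryGroup (Fin d) ℂ) (a : Fin d → ℝ) : Matrix (Fin d) (Fin d) ℂ :=
  (U : Matrix (Fin d) (Fin d) ℂ) * Matrix.diagonal (fun i => (a i : ℂ)) *
    (star U : Matrix (Fin d) (Fin d) ℂ)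

/-- Diagonal entries in the basis `U`. -/
noncomputable def qf (U : unitaryGroup (Fin d) ℂ) (A : Matrix (Fin d) (Fin d) ℂ) (i : Fin d) : ℝ :=
  (((star U : Matrix (Fin d) (Fin d) ℂ) * A * (U : Matrix (Fin d) (Fin d) ℂ)) i i).re

lemma U_star_mul (U : unitaryGroup (Fin d) ℂ) :
    (star U : Matrix (Fin d) (Fin d) ℂ) * (U : Matrix (Fin d) (Fin d) ℂ) = 1 :=
  Unitary.coe_star_mul_self U

lemma U_mul_star (U : unitaryGroup (Fin d) ℂ) :
    (U : Matrix (Fin d) (Fin d) ℂ) * (star U : Matrix (Fin d) (Fin d) ℂ) = 1 :=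
  Unitary.coe_mul_star_self U

lemma cj_herm (U : unitaryGroup (Fin d) ℂ) (a : Fin d → ℝ) : (cj U a).IsHermitian := by
  unfold cj Matrix.IsHermitian
  rw [Matrix.conjTranspose_mul, Matrix.conjTranspose_mul, Matrix.diagonal_conjTranspose]
  simp only [Matrix.star_eq_conjTranspose, Matrix.conjTranspose_conjTranspose, mul_assoc]
  congr 3
  ext i
  simp

lemma cj_congr (U V : unitaryGroup (Fin d) ℂ) (a b : Fin d → ℝ) (f : ℝ → ℝ)
    (h : cj U a = cj V b) : cj U (fun i => f (a i)) = cj V (fun i => f (b i)) := by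
  set T : Matrix (Fin d) (Fin d) ℂ := (star V : Matrix (Fin d) (Fin d) ℂ) * U with hT
  have key : ∀ a b : Fin d → ℝ, cj U a = cj V b ↔
      T * Matrix.diagonal (fun i => (a i : ℂ)) = Matrix.diagonal (fun i => (b i : ℂ)) * T := by
    intro a b
    unfold cj
    constructor
    · intro h
      have h2 := congrArg (fun X => (star V : Matrix (Fin d) (Fin d) ℂ) * X * (U : Matrix (Fin d) (Fin d) ℂ)) h
      simp only [mul_assoc, U_star_mul, mul_one] at h2
      rw [← mul_assoc (star V : Matrix (Fin d) (Fin d) ℂ) (V : Matrix (Fin d) (Fin d) ℂ), U_star_mul, one_mul] at h2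
      rw [hT, mul_assoc, h2]
    · intro h
      have h2 := congrArg (fun X => (V : Matrix (Fin d) (Fin d) ℂ) * X * (star U : Matrix (Fin d) (Fin d) ℂ)) h
      simp only [hT, mul_assoc, U_mul_star, mul_one] at h2
      rw [← mul_assoc (V : Matrix (Fin d) (Fin d) ℂ) (star V : Matrix (Fin d) (Fin d) ℂ), U_mul_star, one_mul] at h2
      rw [mul_assoc, h2, mul_assoc]
  rw [key] at h ⊢
  ext i j
  have hij := congrFun (congrFun h i) j
  simp only [Matrix.mul_diagonal, Matrix.diagonal_mul] at hij ⊢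
  by_cases h0 : T i j = 0
  · simp [h0]
  · have : (a j : ℂ) = b i := by
      apply mul_left_cancel₀ h0
      rw [hij, mul_comm]
    have : a j = b i := by exact_mod_cast this
    rw [this, mul_comm]

lemma exists_cj (A : Matrix (Fin d) (Fin d) ℂ) (hA : A.IsHermitian) :
    A = cj hA.eigenvectorUnitary hA.eigenvalues := by
  conv_lhs => rw [hA.spectral_theorem]
  rfl

lemma matRpow_cj (U : unitaryGroup (Fin d) ℂ) (a : Fin d → ℝ) (r : ℝ) :
    matRpow (cj U a) r = cj U (fun i => a i ^ r) := by
  unfold matRpow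
  rw [dif_pos (cj_herm U a)]
  exact (cj_congr U _ a _ (fun x => x ^ r) (exists_cj _ (cj_herm U a))).symm

lemma cj_mul (U : unitaryGroup (Fin d) ℂ) (a b : Fin d → ℝ) :
    cj U a * cj U b = cj U (fun i => a i * b i) := by
  unfold cj
  have : ∀ D E : Matrix (Fin d) (Fin d) ℂ, (U : Matrix (Fin d) (Fin d) ℂ) * D * (star U : Matrix (Fin d) (Fin d) ℂ) *
    (U * E * (star U : Matrix (Fin d) (Fin d) ℂ)) = U * (D * E) * (star U : Matrix (Fin d) (Fin d) ℂ) := by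
    intro D E
    calc _ = (U : Matrix (Fin d) (Fin d) ℂ) * D * ((star U : Matrix (Fin d) (Fin d) ℂ) * U) * E * (star U : Matrix (Fin d) (Fin d) ℂ) := by
            simp only [mul_assoc]
      _ = _ := by rw [U_star_mul]; simp only [mul_assoc, mul_one]
  rw [this, Matrix.diagonal_mul_diagonal]
  simp

lemma cj_sub (U : unitaryGroup (Fin d) ℂ) (a b : Fin d → ℝ) :
    cj U a - cj U b = cj U (fun i => a i - b i) := by
  unfold cj
  rw [← sub_mul, ← mul_sub, Matrix.diagonal_sub]
  simp

lemma cj_add (U : unitaryGroup (Fin d) ℂ) (a b : Fin d → ℝ) :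
    cj U a + cj U b = cj U (fun i => a i + b i) := by
  unfold cj
  rw [← add_mul, ← mul_add, Matrix.diagonal_add]
  simp

lemma cj_smul (U : unitaryGroup (Fin d) ℂ) (a : Fin d → ℝ) (c : ℝ) :
    c • cj U a = cj U (fun i => c * a i) := by
  unfold cj
  rw [← smul_mul_assoc, ← mul_smul_comm, ← Matrix.diagonal_smul]
  congr 3
  ext i; simp

lemma cj_const (U : unitaryGroup (Fin d) ℂ) (c : ℝ) :
    cj U (fun _ => c) = c • (1 : Matrix (Fin d) (Fin d) ℂ) := by
  have : cj U (fun _ => (1:ℝ)) = 1 := by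
    unfold cj
    simp [U_mul_star]
  rw [← this, cj_smul]; simp

lemma cj_trace (U : unitaryGroup (Fin d) ℂ) (a : Fin d → ℝ) :
    ((cj U a).trace).re = ∑ i, a i := by
  unfold cj
  rw [mul_assoc, Matrix.trace_mul_comm, mul_assoc, U_star_mul]
  simp [Matrix.trace]

lemma cj_nonneg (U : unitaryGroup (Fin d) ℂ) (a : Fin d → ℝ) (h : ∀ i, 0 ≤ a i) :
    0 ≤ cj U a := by
  rw [Matrix.nonneg_iff_posSemidef]
  unfold cj
  apply Matrix.PosSemidef.mul_mul_conjTranspose_same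
  rw [Matrix.posSemidef_diagonal_iff]
  intro i
  exact_mod_cast h i

lemma cj_mono (U : unitaryGroup (Fin d) ℂ) (a b : Fin d → ℝ) (h : ∀ i, a i ≤ b i) :
    cj U a ≤ cj U b := by
  rw [← sub_nonneg, cj_sub]
  exact cj_nonneg _ _ fun i => sub_nonneg.2 (h i)

lemma qf_cj (U : unitaryGroup (Fin d) ℂ) (a : Fin d → ℝ) (i : Fin d) : qf U (cj U a) i = a i := by
  unfold qf cj
  simp only [mul_assoc, U_star_mul, mul_one]
  rw [← mul_assoc, U_star_mul, one_mul]
  simp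

lemma qf_add (U : unitaryGroup (Fin d) ℂ) (A B : Matrix (Fin d) (Fin d) ℂ) (i : Fin d) :
    qf U (A + B) i = qf U A i + qf U B i := by
  simp [qf, mul_add, add_mul]

lemma qf_sub (U : unitaryGroup (Fin d) ℂ) (A B : Matrix (Fin d) (Fin d) ℂ) (i : Fin d) :
    qf U (A - B) i = qf U A i - qf U B i := by
  simp [qf, mul_sub, sub_mul]

lemma qf_smul (U : unitaryGroup (Fin d) ℂ) (A : Matrix (Fin d) (Fin d) ℂ) (c : ℝ) (i : Fin d) :
    qf U (c • A) i = c * qf U A i := by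
  simp [qf]

lemma qf_one (U : unitaryGroup (Fin d) ℂ) (i : Fin d) :
    qf U 1 i = 1 := by
  simp [qf]

lemma qf_sum (U : unitaryGroup (Fin d) ℂ) {ι : Type*} (s : Finset ι) (A : ι → Matrix (Fin d) (Fin d) ℂ) (i : Fin d) :
    qf U (∑ k ∈ s, A k) i = ∑ k ∈ s, qf U (A k) i := by
  simp [qf, Finset.mul_sum, Finset.sum_mul, Matrix.sum_apply]

lemma qf_nonneg (U : unitaryGroup (Fin d) ℂ) (A : Matrix (Fin d) (Fin d) ℂ) (h : 0 ≤ A) (i : Fin d) :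
    0 ≤ qf U A i := by
  rw [Matrix.nonneg_iff_posSemidef] at h
  have := (h.conjTranspose_mul_mul_same (U : Matrix (Fin d) (Fin d) ℂ)).diag_nonneg (i := i)
  exact (Complex.le_def.1 this).1

lemma qf_mono (U : unitaryGroup (Fin d) ℂ) (A B : Matrix (Fin d) (Fin d) ℂ) (h : A ≤ B) (i : Fin d) :
    qf U A i ≤ qf U B i := by
  have := qf_nonneg U (B - A) (sub_nonneg.2 h) i
  rw [qf_sub] at this
  linarith

lemma qf_trace (U : unitaryGroup (Fin d) ℂ) (A : Matrix (Fin d) (Fin d) ℂ) :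
    ∑ i, qf U A i = A.trace.re := by
  have : A.trace = ((star U : Matrix (Fin d) (Fin d) ℂ) * A * (U : Matrix (Fin d) (Fin d) ℂ)).trace := by
    rw [mul_assoc, Matrix.trace_mul_comm, mul_assoc, U_mul_star, mul_one]
  rw [this]
  simp [Matrix.trace, qf]

lemma trace_cj_mul (U : unitaryGroup (Fin d) ℂ) (a : Fin d → ℝ) (A : Matrix (Fin d) (Fin d) ℂ) :
    ((cj U a * A).trace).re = ∑ i, a i * qf U A i := by
  have : (cj U a * A).trace = (Matrix.diagonal (fun i => (a i : ℂ)) *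
      ((star U : Matrix (Fin d) (Fin d) ℂ) * A * (U : Matrix (Fin d) (Fin d) ℂ))).trace := by
    unfold cj
    rw [mul_assoc, mul_assoc, Matrix.trace_mul_comm]
    simp only [mul_assoc]
  rw [this]
  simp [Matrix.trace, qf, Matrix.diagonal_mul]

lemma exists_cj_nonneg (A : Matrix (Fin d) (Fin d) ℂ) (hA : 0 ≤ A) :
    ∃ (U : unitaryGroup (Fin d) ℂ) (a : Fin d → ℝ), (∀ i, 0 ≤ a i) ∧ A = cj U a := by
  have h := Matrix.nonneg_iff_posSemidef.1 hA
  exact ⟨_, _, fun i => h.eigenvalues_nonneg i, exists_cj A h.1⟩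

/-- bridge to the functional calculus power -/
lemma matRpow_eq (A : Matrix (Fin d) (Fin d) ℂ) (hA : 0 ≤ A) (r : ℝ) (hr : 0 ≤ r) :
    matRpow A r = A ^ r := by
  have h := (Matrix.nonneg_iff_posSemidef.1 hA).1
  rw [CFC.rpow_eq_cfc_real hA, h.cfc_eq]
  unfold matRpow
  rw [dif_pos h]
  rfl

lemma matRpow_mono (A B : Matrix (Fin d) (Fin d) ℂ) (hA : 0 ≤ A) (hAB : A ≤ B) (r : ℝ)
    (h0 : 0 ≤ r) (h1 : r ≤ 1) : matRpow A r ≤ matRpow B r := by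
  rw [matRpow_eq A hA r h0, matRpow_eq B (hA.trans hAB) r h0]
  exact CFC.rpow_le_rpow ⟨h0, h1⟩ hAB

lemma cj_inv (U : unitaryGroup (Fin d) ℂ) (a : Fin d → ℝ) (h : ∀ i, a i ≠ 0) :
    cj U a * cj U (fun i => (a i)⁻¹) = 1 := by
  rw [cj_mul]
  simp only [mul_inv_cancel₀ (h _)]
  rw [cj_const]; simp

lemma inv_anti (U V : unitaryGroup (Fin d) ℂ) (a b : Fin d → ℝ) (ha : ∀ i, 0 < a i)
    (hb : ∀ i, 0 < b i) (h : cj U a ≤ cj V b) :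
    cj V (fun i => (b i)⁻¹) ≤ cj U (fun i => (a i)⁻¹) := by
  let u : (Matrix (Fin d) (Fin d) ℂ)ˣ := ⟨cj U a, cj U (fun i => (a i)⁻¹), cj_inv U a fun i => (ha i).ne',
    by have := cj_inv U (fun i => (a i)⁻¹) (fun i => inv_ne_zero (ha i).ne'); simpa using this⟩
  let v : (Matrix (Fin d) (Fin d) ℂ)ˣ := ⟨cj V b, cj V (fun i => (b i)⁻¹), cj_inv V b fun i => (hb i).ne',
    by have := cj_inv V (fun i => (b i)⁻¹) (fun i => inv_ne_zero (hb i).ne'); simpa using this⟩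
  have := CStarAlgebra.inv_le_inv (a := u) (b := v) (cj_nonneg _ _ fun i => (ha i).le) h
  exact this

lemma rpow_anti (U V : unitaryGroup (Fin d) ℂ) (a b : Fin d → ℝ) (ha : ∀ i, 0 < a i)
    (hb : ∀ i, 0 < b i) (h : cj U a ≤ cj V b) (r : ℝ) (h0 : 0 ≤ r) (h1 : r ≤ 1) :
    cj V (fun i => (b i) ^ (r - 1)) ≤ cj U (fun i => (a i) ^ (r - 1)) := by
  have := matRpow_mono _ _ (cj_nonneg U a fun i => (ha i).le) h (1 - r) (by linarith) (by linarith)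
  rw [matRpow_cj, matRpow_cj] at this
  have := inv_anti U V _ _ (fun i => Real.rpow_pos_of_pos (ha i) _)
    (fun i => Real.rpow_pos_of_pos (hb i) _) this
  have e : ∀ x : ℝ, 0 < x → (x ^ (1 - r))⁻¹ = x ^ (r - 1) := by
    intro x hx
    rw [← Real.rpow_neg hx.le]; congr 1; ring
  simp only [e _ (ha _), e _ (hb _)] at this
  exact this

lemma tangent (x y r : ℝ) (hx : 0 ≤ x) (hy : 0 < y) (h0 : 0 ≤ r) (h1 : r ≤ 1) :
    x ^ r ≤ y ^ r + r * y ^ (r - 1) * (x - y) := by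
  have hs : (-1 : ℝ) ≤ x / y - 1 := by
    have : 0 ≤ x / y := by positivity
    linarith
  have h := rpow_one_add_le_one_add_mul_self hs h0 h1
  have e1 : 1 + (x / y - 1) = x / y := by ring
  rw [e1, Real.div_rpow hx hy.le, div_le_iff₀ (Real.rpow_pos_of_pos hy r)] at h
  rw [Real.rpow_sub_one hy.ne']
  calc _ ≤ _ := h
    _ = _ := by field_simp

lemma klein (V V' : unitaryGroup (Fin d) ℂ) (y y' : Fin d → ℝ) (hy : ∀ i, 0 < y i)
    (hy' : ∀ i, 0 ≤ y' i) (r : ℝ) (h0 : 0 ≤ r) (h1 : r ≤ 1) :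
    ∑ i, y' i ^ r ≤ ∑ i, y i ^ r +
      ((cj V (fun i => r * y i ^ (r - 1)) * (cj V' y' - cj V y)).trace).re := by
  rw [trace_cj_mul, ← Finset.sum_add_distrib, ← cj_trace V' (fun i => y' i ^ r), ← qf_trace V]
  apply Finset.sum_le_sum
  intro j _
  have hle : cj V' (fun i => y' i ^ r) ≤
      (y j ^ r - r * y j ^ (r - 1) * y j) • (1 : Matrix (Fin d) (Fin d) ℂ)
        + (r * y j ^ (r - 1)) • cj V' y' := by
    rw [← cj_const V', cj_smul, cj_add]
    apply cj_mono
    intro i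
    have := tangent (y' i) (y j) r (hy' i) (hy j) h0 h1
    linarith
  have := qf_mono V _ _ hle j
  rw [qf_add, qf_smul, qf_smul, qf_one] at this
  rw [qf_sub, qf_cj]
  linarith

/-- trace of the `r`-th power -/
noncomputable def tp (r : ℝ) (A : Matrix (Fin d) (Fin d) ℂ) : ℝ := ((matRpow A r).trace).re

lemma tp_cj (U : unitaryGroup (Fin d) ℂ) (a : Fin d → ℝ) (r : ℝ) :
    tp r (cj U a) = ∑ i, a i ^ r := by
  rw [tp, matRpow_cj, cj_trace]

lemma exists_cj_pos (A : Matrix (Fin d) (Fin d) ℂ) (U : unitaryGroup (Fin d) ℂ) (a : Fin d → ℝ)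
    (ha : ∀ i, 0 < a i) (h : cj U a ≤ A) :
    ∃ (V : unitaryGroup (Fin d) ℂ) (b : Fin d → ℝ), (∀ i, 0 < b i) ∧ A = cj V b := by
  have hp : (cj U a).PosDef := by
    unfold cj
    have := (Matrix.posDef_diagonal_iff (d := fun i => (a i : ℂ))).2 (fun i => by exact_mod_cast ha i)
    refine this.mul_mul_conjTranspose_same (B := (U : Matrix (Fin d) (Fin d) ℂ)) ?_
    apply Matrix.vecMul_injective_of_isUnit
    exact ⟨⟨U, (star U : Matrix (Fin d) (Fin d) ℂ), U_mul_star U, U_star_mul U⟩, rfl⟩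
  have hA : A.PosDef := by
    have := hp.add_posSemidef (Matrix.le_iff.1 h)
    simpa using this
  exact ⟨_, _, fun i => hA.eigenvalues_pos i, exists_cj A hA.1⟩

lemma step (B : Matrix (Fin d) (Fin d) ℂ) (hB : 0 ≤ B) (U : unitaryGroup (Fin d) ℂ)
    (a b : Fin d → ℝ) (ρ r : ℝ) (ha : ∀ i, 0 < a i) (hab : ∀ i, a i ≤ b i)
    (hbρ : ∀ i, b i ≤ ρ * a i) (hρ : 1 ≤ ρ) (h0 : 0 ≤ r) (h1 : r ≤ 1) :
    tp r (B + cj U b) - tp r (B + cj U a) ≤ ρ * (∑ i, b i ^ r - ∑ i, a i ^ r) := by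
  have hb : ∀ i, 0 < b i := fun i => (ha i).trans_le (hab i)
  obtain ⟨V, y, hy, hY⟩ := exists_cj_pos (B + cj U a) U a ha (le_add_of_nonneg_left hB)
  obtain ⟨V', y', hy', hY'⟩ := exists_cj_pos (B + cj U b) U b hb (le_add_of_nonneg_left hB)
  have hk := klein V V' y y' hy (fun i => (hy' i).le) r h0 h1
  have hd : cj V' y' - cj V y = cj U (fun i => b i - a i) := by
    rw [← hY, ← hY', ← cj_sub]; abel
  have hanti : cj V (fun i => y i ^ (r - 1)) ≤ cj U (fun i => a i ^ (r - 1)) := by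
    apply rpow_anti U V a y ha hy _ r h0 h1
    rw [← hY]; exact le_add_of_nonneg_left hB
  rw [hd, Matrix.trace_mul_comm, trace_cj_mul] at hk
  rw [hY, hY', tp_cj, tp_cj, ← Finset.sum_sub_distrib (fun i => b i ^ r), Finset.mul_sum]
  have : ∑ i, (b i - a i) * qf U (cj V fun i => r * y i ^ (r - 1)) i ≤
      ∑ i, ρ * (b i ^ r - a i ^ r) := by
    apply Finset.sum_le_sum
    intro i _
    have h2 : qf U (cj V fun i => r * y i ^ (r - 1)) i ≤ r * a i ^ (r - 1) := by
      rw [← cj_smul, qf_smul]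
      have := qf_mono U _ _ hanti i
      rw [qf_cj] at this
      exact mul_le_mul_of_nonneg_left this h0
    have h3 : a i ^ (r - 1) ≤ ρ * b i ^ (r - 1) := by
      rw [Real.rpow_sub_one (ha i).ne', Real.rpow_sub_one (hb i).ne', ← mul_div_assoc,
        div_le_div_iff₀ (ha i) (hb i)]
      have := Real.rpow_le_rpow (ha i).le (hab i) h0
      have h5 := Real.rpow_nonneg (ha i).le r
      calc a i ^ r * b i ≤ a i ^ r * (ρ * a i) := mul_le_mul_of_nonneg_left (hbρ i) h5
        _ ≤ b i ^ r * (ρ * a i) := mul_le_mul_of_nonneg_right this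
            (by have := (ha i).le; positivity)
        _ = _ := by ring
    have h4 := tangent (a i) (b i) r (ha i).le (hb i) h0 h1
    have h6 : 0 ≤ b i - a i := sub_nonneg.2 (hab i)
    calc (b i - a i) * qf U (cj V fun i => r * y i ^ (r - 1)) i
        ≤ (b i - a i) * (r * (ρ * b i ^ (r - 1))) := by
          apply mul_le_mul_of_nonneg_left _ h6
          exact h2.trans (mul_le_mul_of_nonneg_left h3 h0)
      _ = ρ * (r * b i ^ (r - 1) * (b i - a i)) := by ring
      _ ≤ _ := by
          apply mul_le_mul_of_nonneg_left _ (by linarith)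
          linarith
  linarith

lemma step_pow (B : Matrix (Fin d) (Fin d) ℂ) (hB : 0 ≤ B) (U : unitaryGroup (Fin d) ℂ)
    (ρ r : ℝ) (hρ : 1 ≤ ρ) (h0 : 0 ≤ r) (h1 : r ≤ 1) (k : ℕ) :
    ∀ (a b : Fin d → ℝ), (∀ i, 0 < a i) → (∀ i, a i ≤ b i) → (∀ i, b i ≤ ρ ^ (2 ^ k) * a i) →
    tp r (B + cj U b) - tp r (B + cj U a) ≤ ρ * (∑ i, b i ^ r - ∑ i, a i ^ r) := by
  induction k with
  | zero =>
    intro a b ha hab hb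
    exact step B hB U a b ρ r ha hab (by simpa using hb) hρ h0 h1
  | succ k ih =>
    intro a b ha hab hb
    set c : Fin d → ℝ := fun i => min (b i) (ρ ^ (2 ^ k) * a i) with hc
    have hR : 1 ≤ ρ ^ (2 ^ k) := one_le_pow₀ hρ
    have hac : ∀ i, a i ≤ c i := fun i => le_min (hab i) (by nlinarith [ha i])
    have hcb : ∀ i, c i ≤ b i := fun i => min_le_left _ _
    have hcp : ∀ i, 0 < c i := fun i => (ha i).trans_le (hac i)
    have e1 := ih a c ha hac (fun i => min_le_right _ _)
    have e2 := ih c b hcp hcb (fun i => by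
      have h := hb i
      rw [pow_succ, pow_mul, sq] at h
      rcases min_cases (b i) (ρ ^ (2 ^ k) * a i) with h' | h'
      · simp only [hc, h'.1]; nlinarith [hcp i, hcb i]
      · simp only [hc, h'.1]; linarith)
    nlinarith

lemma ssa (B : Matrix (Fin d) (Fin d) ℂ) (hB : 0 ≤ B) (U : unitaryGroup (Fin d) ℂ)
    (a b : Fin d → ℝ) (r : ℝ) (ha : ∀ i, 0 < a i) (hab : ∀ i, a i ≤ b i)
    (h0 : 0 ≤ r) (h1 : r ≤ 1) :
    tp r (B + cj U b) - tp r (B + cj U a) ≤ (∑ i, b i ^ r - ∑ i, a i ^ r) := by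
  have key : ∀ ε > (0:ℝ), tp r (B + cj U b) - tp r (B + cj U a) ≤
      (1 + ε) * (∑ i, b i ^ r - ∑ i, a i ^ r) := by
    intro ε hε
    have hlt : (1:ℝ) < 1 + ε := by linarith
    obtain ⟨R, hR⟩ : ∃ R : ℝ, ∀ i, b i / a i ≤ R := by
      obtain ⟨R, hR⟩ := (Set.finite_range (fun i => b i / a i)).bddAbove
      exact ⟨R, fun i => hR ⟨i, rfl⟩⟩
    obtain ⟨n, hn⟩ := pow_unbounded_of_one_lt R hlt
    apply step_pow B hB U (1 + ε) r hlt.le h0 h1 n a b ha hab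
    intro i
    rw [← div_le_iff₀ (ha i)]
    refine (hR i).trans (hn.le.trans ?_)
    exact pow_le_pow_right₀ hlt.le Nat.lt_two_pow_self.le
  have lim : Filter.Tendsto (fun ε : ℝ => (1 + ε) * (∑ i, b i ^ r - ∑ i, a i ^ r))
      (nhdsWithin 0 (Set.Ioi 0)) (nhds ((1 + 0) * (∑ i, b i ^ r - ∑ i, a i ^ r))) := by
    apply Filter.Tendsto.mono_left _ nhdsWithin_le_nhds
    apply Continuous.tendsto
    fun_prop
  have := ge_of_tendsto lim (by filter_upwards [self_mem_nhdsWithin] with ε hε using key ε hε)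
  simpa using this

lemma wmaj (A B : Matrix (Fin d) (Fin d) ℂ) (hA : 0 ≤ A) (hB : 0 ≤ B)
    (U V : unitaryGroup (Fin d) ℂ) (h δ : Fin d → ℝ) (r : ℝ) (h0 : 0 < r) (h1 : r ≤ 1)
    (hH : A - B = cj U h) (hD : matRpow A r - matRpow B r = cj V δ) (τ : ℝ) (hτ : 0 < τ) :
    ∑ i, max (δ i - τ ^ r) 0 ≤ ∑ i, max ((max (h i) 0) ^ r - τ ^ r) 0 := by
  set b : Fin d → ℝ := fun i => max (h i) τ with hb
  have hbτ : ∀ i, τ ≤ b i := fun i => le_max_right _ _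
  have hs := ssa B hB U (fun _ => τ) b r (fun _ => hτ) hbτ h0.le h1
  have hY0 : 0 ≤ B + cj U (fun _ => τ) := add_nonneg hB (cj_nonneg _ _ fun _ => hτ.le)
  have hYY : B + cj U (fun _ => τ) ≤ B + cj U b := by
    have := cj_mono U _ _ hbτ
    gcongr
  have hAY : A ≤ B + cj U b := by
    have : A = B + cj U h := by rw [← hH]; abel
    rw [this]
    have := cj_mono U h b (fun i => le_max_left _ _)
    gcongr
  have hYB : matRpow (B + cj U (fun _ => τ)) r ≤ matRpow B r + (τ ^ r) • 1 := by
    obtain ⟨Q, β, hβ, rfl⟩ := exists_cj_nonneg B hB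
    rw [cj_const, ← cj_const Q, cj_add, matRpow_cj, matRpow_cj, ← cj_const Q, cj_add]
    apply cj_mono
    intro i
    exact Real.rpow_add_le_add_rpow (hβ i) hτ.le h0.le h1
  set N := matRpow (B + cj U b) r - matRpow (B + cj U (fun _ => τ)) r with hN
  have hN0 : 0 ≤ N := sub_nonneg.2 (matRpow_mono _ _ hY0 hYY r h0.le h1)
  have hDN : cj V δ ≤ N + (τ ^ r) • 1 := by
    rw [← hD, hN]
    have e := matRpow_mono _ _ hA hAY r h0.le h1
    calc matRpow A r - matRpow B r ≤ matRpow (B + cj U b) r - matRpow B r := by gcongr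
      _ = (matRpow (B + cj U b) r - matRpow B r - (τ ^ r) • 1) + (τ ^ r) • 1 := by abel
      _ ≤ _ := by
        rw [sub_sub]
        exact add_le_add (sub_le_sub_left hYB _) le_rfl
  have hle : ∑ i, max (δ i - τ ^ r) 0 ≤ ∑ i, qf V N i := by
    apply Finset.sum_le_sum
    intro i _
    apply max_le _ (qf_nonneg V N hN0 i)
    have := qf_mono V _ _ hDN i
    rw [qf_cj, qf_add, qf_smul, qf_one] at this
    linarith
  rw [qf_trace, hN, Matrix.trace_sub, Complex.sub_re] at hle
  refine hle.trans (hs.trans ?_)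
  rw [← Finset.sum_sub_distrib]
  apply Finset.sum_le_sum
  intro i _
  simp only [hb]
  rcases le_total (h i) τ with h' | h'
  · rw [max_eq_right h', sub_self]; exact le_max_right _ _
  · rw [max_eq_left h', max_eq_left (hτ.le.trans h')]; exact le_max_left _ _

lemma int_formula (s x R : ℝ) (hs : 2 ≤ s) (hR : 0 ≤ R) (hx : x ≤ R) :
    ∫ u in (0:ℝ)..R, s * (s - 1) * u ^ (s - 2) * max (x - u) 0 = (max x 0) ^ s := by
  rcases le_total x 0 with h | h
  · rw [max_eq_right h, Real.zero_rpow (by linarith)]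
    rw [intervalIntegral.integral_congr (g := fun _ => (0:ℝ))]
    · simp
    · intro u hu
      rw [Set.uIcc_of_le hR] at hu
      have : max (x - u) 0 = 0 := max_eq_right (by linarith [hu.1])
      simp [this]
  · rw [max_eq_left h]
    have hc : Continuous (fun u : ℝ => s * (s - 1) * u ^ (s - 2) * max (x - u) 0) := by
      have : Continuous (fun u : ℝ => u ^ (s - 2)) := Real.continuous_rpow_const (by linarith)
      fun_prop
    rw [← intervalIntegral.integral_add_adjacent_intervals (b := x) (hc.intervalIntegrable _ _) (hc.intervalIntegrable _ _)]
    have e2 : ∫ u in x..R, s * (s - 1) * u ^ (s - 2) * max (x - u) 0 = 0 := by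
      rw [intervalIntegral.integral_congr (g := fun _ => (0:ℝ))]
      · simp
      · intro u hu
        rw [Set.uIcc_of_le hx] at hu
        have : max (x - u) 0 = 0 := max_eq_right (by linarith [hu.1])
        simp [this]
    have e1 : ∫ u in (0:ℝ)..x, s * (s - 1) * u ^ (s - 2) * max (x - u) 0 =
        ∫ u in (0:ℝ)..x, (s * (s - 1) * x) * u ^ (s - 2) - (s * (s - 1)) * u ^ (s - 1) := by
      apply intervalIntegral.integral_congr
      intro u hu
      rw [Set.uIcc_of_le h] at hu
      have e : max (x - u) 0 = x - u := max_eq_left (by linarith [hu.2])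
      have e' : u ^ (s - 1) = u ^ (s - 2) * u := by
        rw [← Real.rpow_add_one' hu.1 (by linarith)]; congr 1; ring
      simp only [e, e']
      ring
    rw [e1, e2, intervalIntegral.integral_sub, intervalIntegral.integral_const_mul,
      intervalIntegral.integral_const_mul, integral_rpow (Or.inl (by linarith)),
      integral_rpow (Or.inl (by linarith)), Real.zero_rpow (by linarith), Real.zero_rpow (by linarith)]
    · have e' : x ^ s = x ^ (s - 2 + 1) * x := by
        rw [← Real.rpow_add_one' h (by linarith)]; congr 1; ring
      have e'' : s - 1 + 1 = s := by ring
      rw [e'', e']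
      have : s - 2 + 1 ≠ 0 := by linarith
      have : s ≠ 0 := by linarith
      have e3 : s - 2 + 1 = s - 1 := by ring
      have : s - 1 ≠ 0 := by linarith
      rw [e3]
      field_simp
      ring
    · apply Continuous.intervalIntegrable
      have : Continuous (fun u : ℝ => u ^ (s - 2)) := Real.continuous_rpow_const (by linarith)
      fun_prop
    · apply Continuous.intervalIntegrable
      have : Continuous (fun u : ℝ => u ^ (s - 1)) := Real.continuous_rpow_const (by linarith)
      fun_prop

lemma maj (x f : Fin d → ℝ) (s : ℝ) (hs : 2 ≤ s)
    (h : ∀ u > 0, ∑ i, max (x i - u) 0 ≤ ∑ i, max (f i - u) 0) :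
    ∑ i, (max (x i) 0) ^ s ≤ ∑ i, (max (f i) 0) ^ s := by
  obtain ⟨R, hR0, hRx, hRf⟩ : ∃ R : ℝ, 0 ≤ R ∧ (∀ i, x i ≤ R) ∧ (∀ i, f i ≤ R) := by
    obtain ⟨R, hR⟩ := (Set.finite_range x).bddAbove
    obtain ⟨R', hR'⟩ := (Set.finite_range f).bddAbove
    refine ⟨max 0 (max R R'), le_max_left _ _, fun i => ?_, fun i => ?_⟩
    · exact (hR ⟨i, rfl⟩).trans ((le_max_left _ _).trans (le_max_right _ _))
    · exact (hR' ⟨i, rfl⟩).trans ((le_max_right _ _).trans (le_max_right _ _))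
  have hc : ∀ x : ℝ, Continuous (fun u : ℝ => s * (s - 1) * u ^ (s - 2) * max (x - u) 0) := by
    intro x
    have : Continuous (fun u : ℝ => u ^ (s - 2)) := Real.continuous_rpow_const (by linarith)
    fun_prop
  rw [Finset.sum_congr rfl fun i _ => (int_formula s (x i) R hs hR0 (hRx i)).symm,
    Finset.sum_congr rfl fun i _ => (int_formula s (f i) R hs hR0 (hRf i)).symm,
    ← intervalIntegral.integral_finset_sum fun i _ => (hc (x i)).intervalIntegrable _ _,
    ← intervalIntegral.integral_finset_sum fun i _ => (hc (f i)).intervalIntegrable _ _]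
  apply intervalIntegral.integral_mono_on_of_le_Ioo hR0
  · exact (continuous_finset_sum _ fun i _ => hc (x i)).intervalIntegrable _ _
  · exact (continuous_finset_sum _ fun i _ => hc (f i)).intervalIntegrable _ _
  · intro u hu
    rw [← Finset.mul_sum, ← Finset.mul_sum]
    apply mul_le_mul_of_nonneg_left (h u hu.1)
    have := Real.rpow_nonneg hu.1.le (s - 2)
    have : 0 ≤ s - 1 := by linarith
    have : 0 ≤ s := by linarith
    positivity

lemma pos_part_bound (A B : Matrix (Fin d) (Fin d) ℂ) (hA : 0 ≤ A) (hB : 0 ≤ B)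
    (U V : unitaryGroup (Fin d) ℂ) (h δ : Fin d → ℝ) (r s : ℝ) (h0 : 0 < r) (h1 : r ≤ 1)
    (hs : 2 ≤ s)
    (hH : A - B = cj U h) (hD : matRpow A r - matRpow B r = cj V δ) :
    ∑ i, (max (δ i) 0) ^ s ≤ ∑ i, (max (h i) 0) ^ (r * s) := by
  have := maj δ (fun i => (max (h i) 0) ^ r) s hs (by
    intro u hu
    have e : (u ^ (1 / r)) ^ r = u := by
      rw [← Real.rpow_mul hu.le, one_div_mul_cancel h0.ne', Real.rpow_one]
    have := wmaj A B hA hB U V h δ r h0 h1 hH hD (u ^ (1 / r)) (Real.rpow_pos_of_pos hu _)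
    rw [e] at this
    exact this)
  refine this.trans (le_of_eq ?_)
  apply Finset.sum_congr rfl
  intro i _
  have hm : 0 ≤ max (h i) 0 := le_max_right _ _
  rw [max_eq_left (Real.rpow_nonneg hm r), ← Real.rpow_mul hm]

lemma cj_neg (U : unitaryGroup (Fin d) ℂ) (a : Fin d → ℝ) : - cj U a = cj U (fun i => - a i) := by
  have := cj_smul U a (-1)
  simpa using this

lemma abs_bound (A B : Matrix (Fin d) (Fin d) ℂ) (hA : 0 ≤ A) (hB : 0 ≤ B)
    (U V : unitaryGroup (Fin d) ℂ) (h δ : Fin d → ℝ) (r s : ℝ) (h0 : 0 < r) (h1 : r ≤ 1)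
    (hs : 2 ≤ s)
    (hH : A - B = cj U h) (hD : matRpow A r - matRpow B r = cj V δ) :
    ∑ i, |δ i| ^ s ≤ ∑ i, |h i| ^ (r * s) := by
  have e1 := pos_part_bound A B hA hB U V h δ r s h0 h1 hs hH hD
  have e2 := pos_part_bound B A hB hA U V (fun i => - h i) (fun i => - δ i) r s h0 h1 hs
    (by rw [← cj_neg, ← hH]; abel) (by rw [← cj_neg, ← hD]; abel)
  have key : ∀ (x t : ℝ), 0 < t → |x| ^ t = (max x 0) ^ t + (max (-x) 0) ^ t := by
    intro x t ht
    rcases le_total x 0 with hx | hx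
    · rw [abs_of_nonpos hx, max_eq_right hx, max_eq_left (by linarith), Real.zero_rpow ht.ne', zero_add]
    · rw [abs_of_nonneg hx, max_eq_left hx, max_eq_right (by linarith), Real.zero_rpow ht.ne', add_zero]
  have hs0 : 0 < s := by linarith
  simp only [key _ s hs0, key _ (r * s) (mul_pos h0 hs0), Finset.sum_add_distrib]
  linarith

lemma schatten_cj (V : unitaryGroup (Fin d) ℂ) (δ : Fin d → ℝ) (s : ℝ) :
    schattenNorm s (cj V δ) = (∑ i, |δ i| ^ s) ^ (1 / s) := by
  unfold schattenNorm
  rw [(cj_herm V δ).eq, cj_mul, matRpow_cj, matRpow_cj, cj_trace]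
  congr 1
  apply Finset.sum_congr rfl
  intro i _
  rw [← Real.sqrt_eq_rpow, Real.sqrt_mul_self_eq_abs]

/-- Peierls: `⟨v, W^α v⟩^{1/α} ≤ ⟨v, W v⟩`. -/
lemma peierls (W : Matrix (Fin d) (Fin d) ℂ) (hW : 0 ≤ W) (U : unitaryGroup (Fin d) ℂ) (α : ℝ)
    (h0 : 0 < α) (h1 : α ≤ 1) (i : Fin d) :
    0 ≤ qf U (matRpow W α) i ∧ qf U (matRpow W α) i ^ (1 / α) ≤ qf U W i := by
  obtain ⟨Q, w, hw, rfl⟩ := exists_cj_nonneg W hW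
  rw [matRpow_cj]
  have hn : 0 ≤ qf U (cj Q fun i => w i ^ α) i :=
    qf_nonneg U _ (cj_nonneg _ _ fun i => Real.rpow_nonneg (hw i) _) i
  refine ⟨hn, ?_⟩
  have hn' := qf_nonneg U _ (cj_nonneg Q w hw) i
  have main : qf U (cj Q fun i => w i ^ α) i ≤ (qf U (cj Q w) i) ^ α := by
    have key : ∀ ε > (0:ℝ), qf U (cj Q fun i => w i ^ α) i ≤ (qf U (cj Q w) i + ε) ^ α := by
      intro ε hε
      set y := qf U (cj Q w) i + ε with hy
      have hy0 : 0 < y := by linarith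
      have hle : cj Q (fun i => w i ^ α) ≤
          (y ^ α - α * y ^ (α - 1) * y) • (1 : Matrix (Fin d) (Fin d) ℂ)
            + (α * y ^ (α - 1)) • cj Q w := by
        rw [← cj_const Q, cj_smul, cj_add]
        apply cj_mono
        intro i
        have := tangent (w i) y α (hw i) hy0 h0.le h1
        linarith
      have := qf_mono U _ _ hle i
      rw [qf_add, qf_smul, qf_smul, qf_one] at this
      have h3 : 0 ≤ α * y ^ (α - 1) := mul_nonneg h0.le (Real.rpow_nonneg hy0.le _)
      have h4 : qf U (cj Q w) i ≤ y := by linarith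
      have := mul_le_mul_of_nonneg_left h4 h3
      linarith
    have lim : Filter.Tendsto (fun ε : ℝ => (qf U (cj Q w) i + ε) ^ α)
        (nhdsWithin 0 (Set.Ioi 0)) (nhds ((qf U (cj Q w) i + 0) ^ α)) := by
      apply Filter.Tendsto.mono_left _ nhdsWithin_le_nhds
      have hc := (Real.continuous_rpow_const (q := α) h0.le).comp
        (continuous_const.add continuous_id : Continuous fun ε : ℝ => qf U (cj Q w) i + ε)
      exact hc.tendsto 0
    have := ge_of_tendsto lim (by filter_upwards [self_mem_nhdsWithin] with ε hε using key ε hε)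
    simpa using this
  calc _ ≤ ((qf U (cj Q w) i) ^ α) ^ (1 / α) := Real.rpow_le_rpow hn main (by positivity)
    _ = _ := by rw [← Real.rpow_mul hn', mul_one_div_cancel h0.ne', Real.rpow_one]

lemma scalar_jensen {n : ℕ} (x a : Fin n → ℝ) (t : ℝ) (ht : 1 ≤ t) (ha : ∀ k, 0 ≤ a k)
    (hS : 0 < ∑ k, |x k|) :
    |∑ k, x k * a k| ^ t ≤ (∑ k, |x k|) ^ (t - 1) * ∑ k, |x k| * a k ^ t := by
  set S := ∑ k, |x k| with hSd
  have hj := Real.rpow_arith_mean_le_arith_mean_rpow Finset.univ (fun k => |x k| / S) a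
    (fun k _ => by positivity) (by rw [← Finset.sum_div]; exact div_self hS.ne')
    (fun k _ => ha k) ht
  have e1 : ∑ k, |x k| / S * a k = (∑ k, |x k| * a k) / S := by
    rw [Finset.sum_div]; exact Finset.sum_congr rfl fun k _ => by ring
  have e2 : ∑ k, |x k| / S * a k ^ t = (∑ k, |x k| * a k ^ t) / S := by
    rw [Finset.sum_div]; exact Finset.sum_congr rfl fun k _ => by ring
  have hp : 0 ≤ ∑ k, |x k| * a k := Finset.sum_nonneg fun k _ => mul_nonneg (abs_nonneg _) (ha k)
  rw [e1, e2, Real.div_rpow hp hS.le, div_le_div_iff₀ (Real.rpow_pos_of_pos hS t) hS] at hj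
  have h1 : |∑ k, x k * a k| ≤ ∑ k, |x k| * a k := by
    refine (Finset.abs_sum_le_sum_abs _ _).trans (le_of_eq ?_)
    exact Finset.sum_congr rfl fun k _ => by rw [abs_mul, abs_of_nonneg (ha k)]
  refine (Real.rpow_le_rpow (abs_nonneg _) h1 (by linarith)).trans ?_
  rw [Real.rpow_sub_one hS.ne', div_mul_eq_mul_div, le_div_iff₀ hS]
  linarith

end Helpers

/-- Schatten-norm Hölder bound for the powered difference. -/
theorem schatten_holder_bound {n d : ℕ} (hn : 0 < n) (hd : 0 < d) (α : ℝ)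
    (hα : α ∈ Set.Ico (1 / 2 : ℝ) 1)
    (W : Fin n → Matrix (Fin d) (Fin d) ℂ)
    (hW : ∀ j, (W j).PosSemidef ∧ (W j).trace = 1)
    (p q : Fin n → ℝ) (hp : p ∈ stdSimplex ℝ (Fin n)) (hq : q ∈ stdSimplex ℝ (Fin n)) :
    schattenNorm (1 / (1 - α))
        (matRpow (∑ k, p k • matRpow (W k) α) ((1 - α) / α)
          - matRpow (∑ k, q k • matRpow (W k) α) ((1 - α) / α))
      ≤ (∑ k, |p k - q k|) ^ ((1 - α) / α) := by
  obtain ⟨ha, hb⟩ := hα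
  have hα0 : 0 < α := by linarith
  have h1α : 0 < 1 - α := by linarith
  have hW0 : ∀ k, 0 ≤ W k := fun k => Matrix.nonneg_iff_posSemidef.2 (hW k).1
  have hV0 : ∀ k, 0 ≤ matRpow (W k) α := by
    intro k
    obtain ⟨Q, w, hw, e⟩ := exists_cj_nonneg _ (hW0 k)
    rw [e, matRpow_cj]
    exact cj_nonneg _ _ fun i => Real.rpow_nonneg (hw i) _
  have hsum : ∀ p : Fin n → ℝ, p ∈ stdSimplex ℝ (Fin n) → 0 ≤ ∑ k, p k • matRpow (W k) α := by
    intro p hp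
    apply Finset.sum_nonneg
    intro k _
    obtain ⟨Q, v, hv, e⟩ := exists_cj_nonneg _ (hV0 k)
    rw [e, cj_smul]
    exact cj_nonneg _ _ fun i => mul_nonneg (hp.1 k) (hv i)
  set A := ∑ k, p k • matRpow (W k) α with hA
  set B := ∑ k, q k • matRpow (W k) α with hB
  set r := (1 - α) / α with hr
  set s := 1 / (1 - α) with hs
  have hA0 : 0 ≤ A := hsum p hp
  have hB0 : 0 ≤ B := hsum q hq
  have hr0 : 0 < r := div_pos h1α hα0
  have hr1 : r ≤ 1 := by rw [hr, div_le_one hα0]; linarith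
  have hs2 : 2 ≤ s := by rw [hs, le_div_iff₀ h1α]; linarith
  have hrs : r * s = 1 / α := by rw [hr, hs]; field_simp
  have herm : ∀ M : Matrix (Fin d) (Fin d) ℂ, 0 ≤ M → (matRpow M r).IsHermitian := by
    intro M hM
    obtain ⟨Q, w, hw, rfl⟩ := exists_cj_nonneg M hM
    rw [matRpow_cj]; exact cj_herm _ _
  have hAh := (Matrix.nonneg_iff_posSemidef.1 hA0).1
  have hBh := (Matrix.nonneg_iff_posSemidef.1 hB0).1
  obtain ⟨U, h, hH⟩ : ∃ (U : unitaryGroup (Fin d) ℂ) (h : Fin d → ℝ), A - B = cj U h :=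
    ⟨_, _, exists_cj _ (hAh.sub hBh)⟩
  obtain ⟨V, δ, hD⟩ : ∃ (U : unitaryGroup (Fin d) ℂ) (h : Fin d → ℝ),
      matRpow A r - matRpow B r = cj U h :=
    ⟨_, _, exists_cj _ ((herm A hA0).sub (herm B hB0))⟩
  have hmain := abs_bound A B hA0 hB0 U V h δ r s hr0 hr1 hs2 hH hD
  rw [hD, schatten_cj]
  set S := ∑ k, |p k - q k| with hS
  have hS0 : 0 ≤ S := Finset.sum_nonneg fun k _ => abs_nonneg _
  have hh : ∀ i, h i = ∑ k, (p k - q k) * qf U (matRpow (W k) α) i := by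
    intro i
    rw [← qf_cj U h i, ← hH, hA, hB, ← Finset.sum_sub_distrib, qf_sum]
    apply Finset.sum_congr rfl
    intro k _
    rw [← sub_smul, qf_smul]
  have hbound : ∑ i, |h i| ^ (r * s) ≤ S ^ (r * s) := by
    rw [hrs]
    have ht : 1 ≤ 1 / α := by rw [le_div_iff₀ hα0]; linarith
    rcases hS0.eq_or_lt with hz | hpos
    · have hz' : ∀ k, p k - q k = 0 := by
        intro k
        have := (Finset.sum_eq_zero_iff_of_nonneg (fun k _ => abs_nonneg (p k - q k))).1 hz.symm k
          (Finset.mem_univ k)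
        simpa using this
      have : ∀ i, h i = 0 := by
        intro i; rw [hh]; simp [hz']
      have hne : (1 / α) ≠ 0 := by positivity
      simp only [this, abs_zero, Real.zero_rpow hne, Finset.sum_const_zero]
      exact Real.rpow_nonneg hS0 _
    · calc ∑ i, |h i| ^ (1 / α)
          ≤ ∑ i, S ^ (1 / α - 1) * ∑ k, |p k - q k| * qf U (W k) i := by
            apply Finset.sum_le_sum
            intro i _
            rw [hh i]
            refine (scalar_jensen (fun k => p k - q k) (fun k => qf U (matRpow (W k) α) i) (1 / α)
              ht (fun k => (peierls (W k) (hW0 k) U α hα0 hb.le i).1) hpos).trans ?_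
            apply mul_le_mul_of_nonneg_left _ (Real.rpow_nonneg hS0 _)
            apply Finset.sum_le_sum
            intro k _
            exact mul_le_mul_of_nonneg_left (peierls (W k) (hW0 k) U α hα0 hb.le i).2 (abs_nonneg _)
        _ = S ^ (1 / α - 1) * ∑ k, |p k - q k| * ∑ i, qf U (W k) i := by
            rw [← Finset.mul_sum, Finset.sum_comm]
            simp only [Finset.mul_sum]
        _ = S ^ (1 / α - 1) * S := by
            congr 1
            apply Finset.sum_congr rfl
            intro k _
            rw [qf_trace, (hW k).2]; simp
        _ = S ^ (1 / α) := by
            rw [Real.rpow_sub_one hpos.ne']; field_simp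
  have hs0 : 0 < s := by linarith
  calc (∑ i, |δ i| ^ s) ^ (1 / s) ≤ (S ^ (r * s)) ^ (1 / s) := by
        apply Real.rpow_le_rpow _ (hmain.trans hbound) (by positivity)
        exact Finset.sum_nonneg fun i _ => Real.rpow_nonneg (abs_nonneg _) _
    _ = S ^ r := by
        rw [← Real.rpow_mul hS0]; congr 1; field_simp
end

section
/- Let α ∈ [1/2, 1). For all p, q ∈ Δ_n, writing A_p := Σ_{k=1}^n p[k] W(k)^α and A_q := Σ_{k=1}^n q[k] W(k)^α, and setting d_j := (1/α)·(Tr[A_p^{(1−α)/α} W(j)^α] − Tr[A_q^{(1−α)/α} W(j)^α]) for each j, one has (Σ_{j=1}^n d_j^2)^{1/2} ≤ (n^{1/(2α)}/α)·(Σ_{k=1}^n (p[k] − q[k])^2)^{(1−α)/(2α)}. (This is the coordinate-wise form of the statement that g̃_α is (1/α − 1, n^{1/(2α)}/α)-Hölder smooth on Δ_n with respect to the ℓ2-norm.) -/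
open Matrix
open scoped ComplexOrder

namespace HS

/-- Matrix with spectral data `V`, `e`. -/
noncomputable def spec {d : ℕ} (V : Matrix (Fin d) (Fin d) ℂ) (e : Fin d → ℝ) :
    Matrix (Fin d) (Fin d) ℂ :=
  V * Matrix.diagonal (fun i => ((e i : ℝ) : ℂ)) * Vᴴ

variable {d : ℕ} {V : Matrix (Fin d) (Fin d) ℂ}

lemma spec_mul (hV : Vᴴ * V = 1) (e f : Fin d → ℝ) :
    spec V e * spec V f = spec V (fun i => e i * f i) := by
  unfold spec
  have : V * diagonal (fun i => ((e i : ℝ) : ℂ)) * Vᴴ * (V * diagonal (fun i => ((f i : ℝ) : ℂ)) * Vᴴ)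
      = V * diagonal (fun i => ((e i : ℝ) : ℂ)) * (Vᴴ * V) * diagonal (fun i => ((f i : ℝ) : ℂ)) * Vᴴ := by
    simp only [Matrix.mul_assoc]
  rw [this, hV, Matrix.mul_one, Matrix.mul_assoc V, Matrix.diagonal_mul_diagonal]
  simp

lemma spec_herm (e : Fin d → ℝ) : (spec V e)ᴴ = spec V e := by
  unfold spec
  simp only [Matrix.conjTranspose_mul, Matrix.conjTranspose_conjTranspose,
    Matrix.diagonal_conjTranspose, Matrix.mul_assoc]
  congr 3
  ext i
  simp

lemma spec_one (hV : Vᴴ * V = 1) : spec V (fun _ => 1) = 1 := by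
  unfold spec
  simp only [Complex.ofReal_one, Matrix.diagonal_one, Matrix.mul_one]
  exact mul_eq_one_comm.mp hV

lemma spec_add (e f : Fin d → ℝ) : spec V e + spec V f = spec V (fun i => e i + f i) := by
  unfold spec
  rw [← Matrix.add_mul, ← Matrix.mul_add, Matrix.diagonal_add]
  simp

lemma spec_sub (e f : Fin d → ℝ) : spec V e - spec V f = spec V (fun i => e i - f i) := by
  unfold spec
  rw [← Matrix.sub_mul, ← Matrix.mul_sub, Matrix.diagonal_sub]
  simp

lemma spec_smul (c : ℝ) (e : Fin d → ℝ) : c • spec V e = spec V (fun i => c * e i) := by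
  unfold spec
  rw [← Matrix.smul_mul, ← Matrix.mul_smul]
  congr 2
  ext i j
  by_cases h : i = j
  · subst h; simp
  · simp [h]

lemma spec_psd {e : Fin d → ℝ} (he : ∀ i, 0 ≤ e i) : (spec V e).PosSemidef := by
  unfold spec
  apply Matrix.PosSemidef.mul_mul_conjTranspose_same
  rw [Matrix.posSemidef_diagonal_iff]
  intro i
  exact_mod_cast he i

lemma exists_spec {A : Matrix (Fin d) (Fin d) ℂ} (hA : A.PosSemidef) :
    ∃ (V : Matrix (Fin d) (Fin d) ℂ) (e : Fin d → ℝ), Vᴴ * V = 1 ∧ (∀ i, 0 ≤ e i) ∧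
      A = spec V e ∧ ∀ r : ℝ, matRpow A r = spec V (fun i => e i ^ r) := by
  refine ⟨hA.1.eigenvectorUnitary, hA.1.eigenvalues, ?_, hA.eigenvalues_nonneg, ?_, ?_⟩
  · exact Unitary.coe_star_mul_self _
  · have := hA.1.spectral_theorem
    rw [Unitary.conjStarAlgAut_apply] at this
    exact this
  · intro r
    unfold matRpow
    rw [dif_pos hA.1]
    rfl

lemma psd_smul {A : Matrix (Fin d) (Fin d) ℂ} (hA : A.PosSemidef) {c : ℝ} (hc : 0 ≤ c) :
    (c • A).PosSemidef := hA.smul hc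

lemma trace_spec_re (hV : Vᴴ * V = 1) (e : Fin d → ℝ) : (spec V e).trace.re = ∑ i, e i := by
  unfold spec
  rw [Matrix.trace_mul_comm, ← Matrix.mul_assoc, hV, Matrix.one_mul, Matrix.trace_diagonal]
  simp

lemma trace_spec_mul_re (e : Fin d → ℝ) (C : Matrix (Fin d) (Fin d) ℂ) :
    (spec V e * C).trace.re = ∑ i, e i * ((Vᴴ * C * V) i i).re := by
  unfold spec
  have : V * diagonal (fun i => ((e i : ℝ) : ℂ)) * Vᴴ * C = V * (diagonal (fun i => ((e i : ℝ) : ℂ)) * (Vᴴ * C)) := by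
    simp only [Matrix.mul_assoc]
  rw [this, Matrix.trace_mul_comm, Matrix.mul_assoc, Matrix.trace]
  simp [Matrix.diagonal_mul]

lemma trace_mul_nonneg {D C : Matrix (Fin d) (Fin d) ℂ} (hD : D.PosSemidef) (hC : C.PosSemidef) :
    0 ≤ (D * C).trace.re := by
  obtain ⟨Z, c, hZ, hc, rfl, -⟩ := exists_spec hC
  rw [Matrix.trace_mul_comm, trace_spec_mul_re]
  refine Finset.sum_nonneg fun i _ => mul_nonneg (hc i) ?_
  have := (hD.conjTranspose_mul_mul_same Z).diag_nonneg (i := i)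
  exact (Complex.le_def.mp this).1

lemma trace_mul_mono {X Y C : Matrix (Fin d) (Fin d) ℂ} (hD : (Y - X).PosSemidef)
    (hC : C.PosSemidef) : (X * C).trace.re ≤ (Y * C).trace.re := by
  have := trace_mul_nonneg hD hC
  rw [Matrix.sub_mul, Matrix.trace_sub, Complex.sub_re] at this
  linarith

lemma trace_form {Z K : Matrix (Fin d) (Fin d) ℂ} (f c : Fin d → ℝ) :
    (Kᴴ * spec V f * K * spec Z c).trace.re
      = ∑ i, ∑ j, Complex.normSq ((Vᴴ * K * Z) i j) * (f i * c j) := by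
  have : (Kᴴ * spec V f * K * spec Z c).trace = (spec V f * (K * spec Z c * Kᴴ)).trace := by
    rw [Matrix.mul_assoc, Matrix.mul_assoc, Matrix.trace_mul_comm, Matrix.mul_assoc, Matrix.mul_assoc]
  rw [this, trace_spec_mul_re]
  refine Finset.sum_congr rfl fun i _ => ?_
  have h2 : Vᴴ * (K * spec Z c * Kᴴ) * V
      = (Vᴴ * K * Z) * diagonal (fun i => ((c i : ℝ) : ℂ)) * (Vᴴ * K * Z)ᴴ := by
    unfold spec
    simp only [Matrix.conjTranspose_mul, Matrix.conjTranspose_conjTranspose, Matrix.mul_assoc]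
  rw [h2]
  generalize Vᴴ * K * Z = L
  rw [Matrix.mul_apply, Complex.re_sum, Finset.mul_sum]
  refine Finset.sum_congr rfl fun j _ => ?_
  rw [Matrix.mul_diagonal, Matrix.conjTranspose_apply]
  simp [Complex.normSq_apply]
  ring

/-- contraction -/
def Contr (K : Matrix (Fin d) (Fin d) ℂ) : Prop :=
  (1 - Kᴴ * K).PosSemidef ∧ (1 - K * Kᴴ).PosSemidef

lemma contr_unitary (hV : Vᴴ * V = 1) : Contr V := by
  have h2 : V * Vᴴ = 1 := mul_eq_one_comm.mp hV
  constructor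
  · rw [hV, sub_self]; exact .zero
  · rw [h2, sub_self]; exact .zero

lemma Contr.conj {K : Matrix (Fin d) (Fin d) ℂ} (h : Contr K) : Contr Kᴴ := by
  constructor
  · simpa using h.2
  · simpa using h.1

lemma Contr.mul {K L : Matrix (Fin d) (Fin d) ℂ} (hK : Contr K) (hL : Contr L) : Contr (K * L) := by
  constructor
  · have := (hK.1.conjTranspose_mul_mul_same L).add hL.1
    convert this using 1
    simp only [Matrix.conjTranspose_mul]
    noncomm_ring
  · have := (hL.2.mul_mul_conjTranspose_same K).add hK.2
    convert this using 1
    simp only [Matrix.conjTranspose_mul]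
    noncomm_ring

lemma Contr.row {K : Matrix (Fin d) (Fin d) ℂ} (h : Contr K) (i : Fin d) :
    ∑ j, Complex.normSq (K i j) ≤ 1 := by
  have := (Complex.le_def.mp (h.2.diag_nonneg (i := i))).1
  rw [Matrix.sub_apply, Matrix.mul_apply] at this
  simp [Complex.normSq_apply] at this ⊢
  linarith

lemma Contr.col {K : Matrix (Fin d) (Fin d) ℂ} (h : Contr K) (j : Fin d) :
    ∑ i, Complex.normSq (K i j) ≤ 1 := by
  have := h.conj.row j
  simpa [Complex.normSq_conj] using this

lemma inv_antitone {X Y Xi Yi : Matrix (Fin d) (Fin d) ℂ} (hX : Xi.PosSemidef) (hYi : Yiᴴ = Yi)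
    (h1 : X * Xi = 1) (h2 : Y * Yi = 1) (h : (Y - X).PosSemidef) : (Xi - Yi).PosSemidef := by
  have h1' : Xi * X = 1 := mul_eq_one_comm.mp h1
  have h2' : Yi * Y = 1 := mul_eq_one_comm.mp h2
  have key : Xi - Yi = Yiᴴ * ((Y - X) + (Y - X)ᴴ * Xi * (Y - X)) * Yi := by
    rw [hYi, h.1.eq]
    have e1 : (Y - X) + (Y - X) * Xi * (Y - X) = Y * Xi * Y - Y := by
      have : (Y - X) + (Y - X) * Xi * (Y - X)
        = Y - X + Y * Xi * Y - Y * (Xi * X) - (X * Xi) * Y + (X * Xi) * X := by noncomm_ring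
      rw [this, h1, h1']; noncomm_ring
    rw [e1]
    have : Yi * (Y * Xi * Y - Y) * Yi = (Yi * Y) * Xi * (Y * Yi) - (Yi * Y) * Yi := by noncomm_ring
    rw [this, h2, h2']; simp
  rw [key]
  exact (h.add (hX.conjTranspose_mul_mul_same _)).conjTranspose_mul_mul_same _

lemma resolvent_contr {A E : Matrix (Fin d) (Fin d) ℂ} {W Q : Matrix (Fin d) (Fin d) ℂ}
    {a e w : Fin d → ℝ} {l : ℝ} (hl : 0 < l) (hQ : Qᴴ * Q = 1) (hV : Vᴴ * V = 1) (hW : Wᴴ * W = 1)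
    (ha : ∀ i, 0 ≤ a i) (he : ∀ i, 0 ≤ e i) (hw : ∀ i, 0 ≤ w i)
    (hA : A = spec Q a) (hE : E = spec V e) (hAE : A + E = spec W w) :
    ∃ K, Contr K ∧ (Kᴴ * spec V (fun i => l⁻¹ - (l + e i)⁻¹) * K
      - (spec Q (fun i => (l + a i)⁻¹) - spec W (fun i => (l + w i)⁻¹))).PosSemidef := by
  have hla : ∀ i, 0 < l + a i := fun i => by have := ha i; linarith
  have hle : ∀ i, 0 < l + e i := fun i => by have := he i; linarith
  have hlw : ∀ i, 0 < l + w i := fun i => by have := hw i; linarith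
  set R := spec Q (fun i => (l + a i)⁻¹) with hR
  set P := spec Q (fun i => (√(l + a i))⁻¹) with hP
  set Pi := spec Q (fun i => √(l + a i)) with hPi
  set B := spec V (fun i => √(e i)) with hB
  have hPP : P * P = R := by
    rw [hP, spec_mul hQ, hR]
    congr 1; ext i
    rw [← mul_inv, Real.mul_self_sqrt (hla i).le]
  have hPPi : P * Pi = 1 := by
    rw [hP, hPi, spec_mul hQ, ← spec_one hQ]
    congr 1; ext i
    have := Real.sqrt_pos.mpr (hla i)
    field_simp
  have hPiP : Pi * P = 1 := mul_eq_one_comm.mp hPPi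
  have hBB : B * B = E := by
    rw [hB, spec_mul hV, hE]
    congr 1; ext i
    exact Real.mul_self_sqrt (he i)
  have hPh : Pᴴ = P := spec_herm _
  have hBh : Bᴴ = B := spec_herm _
  have hXpsd : (P * E * P).PosSemidef := by
    have := (hE ▸ spec_psd he : E.PosSemidef).conjTranspose_mul_mul_same P
    rwa [hPh] at this
  obtain ⟨U, x, hU, hx, hX, -⟩ := exists_spec hXpsd
  have hx1 : ∀ i, 0 < 1 + x i := fun i => by have := hx i; linarith
  set S := spec U (fun i => (√(x i))⁻¹) with hS
  have hSh : Sᴴ = S := spec_herm _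
  set Y := B * P * S with hY
  have hYh : Yᴴ = S * P * B := by
    rw [hY]; simp only [Matrix.conjTranspose_mul, hSh, hPh, hBh, Matrix.mul_assoc]
  set J := spec U (fun i => if x i = 0 then 0 else 1) with hJ
  have hYY : Yᴴ * Y = J := by
    have : Yᴴ * Y = S * (P * (B * B) * P) * S := by
      rw [hYh, hY]; noncomm_ring
    rw [this, hBB, hX, hS, spec_mul hU, spec_mul hU, hJ]
    congr 1; ext i
    split_ifs with h
    · simp [h]
    · have h0 : 0 < x i := lt_of_le_of_ne (hx i) (Ne.symm h)
      have h1 := Real.sqrt_pos.mpr h0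
      field_simp
      rw [Real.sq_sqrt h0.le]
  have hSJ : S * J = S := by
    rw [hS, hJ, spec_mul hU]
    congr 1; ext i
    split_ifs with h
    · simp [h]
    · simp
  have hYJ : Y * J = Y := by rw [hY, Matrix.mul_assoc, hSJ]
  have hYc : Contr Y := by
    constructor
    · rw [hYY, hJ, ← spec_one hU, spec_sub]
      apply spec_psd
      intro i; split_ifs <;> simp
    · have : 1 - Y * Yᴴ = (1 - Y * Yᴴ)ᴴ * (1 - Y * Yᴴ) := by
        simp only [Matrix.conjTranspose_sub, Matrix.conjTranspose_one, Matrix.conjTranspose_mul,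
          Matrix.conjTranspose_conjTranspose]
        have h3 : (1 - Y * Yᴴ) * (1 - Y * Yᴴ) = 1 - Y * Yᴴ - Y * Yᴴ + Y * (Yᴴ * Y) * Yᴴ := by
          noncomm_ring
        rw [h3, hYY, hYJ]; noncomm_ring
      rw [this]
      exact Matrix.posSemidef_conjTranspose_mul_self _
  -- the matrix G
  set G := B * R * B with hG
  have hRpsd : R.PosSemidef := spec_psd fun i => (inv_pos.mpr (hla i)).le
  have hGpsd : G.PosSemidef := by
    have := hRpsd.conjTranspose_mul_mul_same B
    rwa [hBh] at this
  obtain ⟨O, g, hO, hg, hGO, -⟩ := exists_spec hGpsd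
  have hg1 : ∀ i, 0 < 1 + g i := fun i => by have := hg i; linarith
  set Gi := spec O (fun i => (1 + g i)⁻¹) with hGi
  have hGiG : (1 + G) * Gi = 1 := by
    rw [hGO, hGi, ← spec_one hO, spec_add, spec_mul hO]
    congr 1; ext i
    exact mul_inv_cancel₀ (hg1 i).ne'
  have hGiG' : Gi * (1 + G) = 1 := mul_eq_one_comm.mp hGiG
  set Fi := spec V (fun i => (1 + l⁻¹ * e i)⁻¹) with hFi
  have hF : (1 + l⁻¹ • E) * Fi = 1 := by
    rw [hE, hFi, spec_smul, ← spec_one hV, spec_add, spec_mul hV]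
    congr 1; ext i
    have := he i
    exact mul_inv_cancel₀ (by positivity)
  have hcomp : (Gi - Fi).PosSemidef := by
    refine inv_antitone (X := 1 + G) (Y := 1 + l⁻¹ • E) (spec_psd fun i => (inv_pos.mpr (hg1 i)).le) (spec_herm _) hGiG hF ?_
    have hd : (1 + l⁻¹ • E) - (1 + G) = Bᴴ * (l⁻¹ • 1 - R) * B := by
      rw [hBh, hG, ← hBB]
      simp only [Matrix.mul_sub, Matrix.sub_mul, Matrix.mul_smul, Matrix.smul_mul, Matrix.mul_one]
      abel
    rw [hd]
    apply Matrix.PosSemidef.conjTranspose_mul_mul_same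
    rw [← spec_one hQ, spec_smul, hR, spec_sub]
    apply spec_psd
    intro i
    rw [mul_one, sub_nonneg]
    have := ha i
    gcongr
    linarith
  set N := spec U (fun i => (1 + x i)⁻¹) with hN
  set X := P * E * P with hXdef
  have hXN : (1 + X) * N = 1 := by
    rw [hX, hN, ← spec_one hU, spec_add, spec_mul hU]
    congr 1; ext i
    exact mul_inv_cancel₀ (hx1 i).ne'
  have hXS : X * S = S * X := by
    rw [hX, hS, spec_mul hU, spec_mul hU]
    congr 1; ext i; ring
  have hGY : (1 + G) * Y = Y * (1 + X) := by
    have e1 : G * Y = B * P * (P * (B * B) * P * S) := by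
      rw [hG, hY, ← hPP]; noncomm_ring
    rw [hBB, ← hXdef, hXS] at e1
    rw [Matrix.add_mul, e1, hY]; noncomm_ring
  have hGiY : Gi * Y = Y * N := by
    calc Gi * Y = Gi * (Y * ((1 + X) * N)) := by rw [hXN, Matrix.mul_one]
      _ = Gi * ((Y * (1 + X)) * N) := by rw [Matrix.mul_assoc Y]
      _ = (Gi * (1 + G)) * Y * N := by rw [← hGY]; noncomm_ring
      _ = Y * N := by rw [hGiG', Matrix.one_mul]
  have hW2 : spec W (fun i => (l + w i)⁻¹) = P * N * P := by
    have h1 : (l • 1 + (A + E)) * spec W (fun i => (l + w i)⁻¹) = 1 := by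
      rw [hAE, ← spec_one hW, spec_smul, spec_add, spec_mul hW]
      congr 1; ext i
      rw [mul_one]
      exact mul_inv_cancel₀ (hlw i).ne'
    have hM : l • 1 + A = Pi * Pi := by
      rw [hA, ← spec_one hQ, spec_smul, spec_add, hPi, spec_mul hQ]
      congr 1; ext i
      rw [mul_one, Real.mul_self_sqrt (hla i).le]
    have hE2 : E = Pi * X * Pi := by
      have : Pi * X * Pi = (Pi * P) * E * (P * Pi) := by rw [hXdef]; noncomm_ring
      rw [this, hPiP, hPPi]; simp
    have h2 : (l • 1 + (A + E)) = Pi * (1 + X) * Pi := by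
      rw [← add_assoc, hM]; nth_rewrite 1 [hE2]; noncomm_ring
    have h3 : (P * N * P) * (l • 1 + (A + E)) = 1 := by
      have hNX : N * (1 + X) = 1 := mul_eq_one_comm.mp hXN
      rw [h2]
      have : P * N * P * (Pi * (1 + X) * Pi) = P * (N * ((P * Pi) * (1 + X))) * Pi := by noncomm_ring
      rw [this, hPPi, Matrix.one_mul, hNX, Matrix.mul_one, hPPi]
    calc spec W (fun i => (l + w i)⁻¹) = ((P * N * P) * (l • 1 + (A + E))) * spec W (fun i => (l + w i)⁻¹) := by
          rw [h3, Matrix.one_mul]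
      _ = _ := by rw [Matrix.mul_assoc, h1, Matrix.mul_one]
  refine ⟨√l • (Y * P), ?_, ?_⟩
  · rw [← Matrix.mul_smul]
    refine hYc.mul ?_
    have hPl : (1 - (√l • P) * (√l • P)).PosSemidef := by
      have hll : √l * √l = l := Real.mul_self_sqrt hl.le
      rw [Matrix.smul_mul, Matrix.mul_smul, hPP, smul_smul, hll, ← spec_one hQ, hR, spec_smul, spec_sub]
      apply spec_psd
      intro i
      rw [sub_nonneg, ← div_eq_mul_inv, div_le_one (hla i)]
      have := ha i
      linarith
    have hPlh : (√l • P)ᴴ = √l • P := by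
      rw [Matrix.conjTranspose_smul, hPh]; simp
    constructor
    · rw [hPlh]; exact hPl
    · rw [hPlh]; exact hPl
  · have hll : √l * √l = l := Real.mul_self_sqrt hl.le
    have hspec : l • spec V (fun i => l⁻¹ - (l + e i)⁻¹) = 1 - Fi := by
      rw [← spec_one hV, hFi, spec_smul, spec_sub]
      congr 1; ext i
      have := he i
      have := hle i
      field_simp
    have hL : (√l • (Y * P))ᴴ * spec V (fun i => l⁻¹ - (l + e i)⁻¹) * (√l • (Y * P))
        = P * Yᴴ * (1 - Fi) * Y * P := by
      rw [← hspec, Matrix.conjTranspose_smul, Matrix.conjTranspose_mul, hPh]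
      simp only [Matrix.smul_mul, Matrix.mul_smul, smul_smul, star_trivial, hll, Matrix.mul_assoc]
    rw [hL, hW2, ← hPP]
    have hJN : Yᴴ * Y - Yᴴ * Gi * Y = 1 - N := by
      rw [Matrix.mul_assoc Yᴴ Gi Y, hGiY, ← Matrix.mul_assoc Yᴴ Y N, hYY, hJ, hN, spec_mul hU, spec_sub, ← spec_one hU, spec_sub]
      congr 1; ext i
      split_ifs with h
      · simp [h]
      · simp
    have : P * Yᴴ * (1 - Fi) * Y * P - (P * P - P * N * P)
        = (Y * P)ᴴ * (Gi - Fi) * (Y * P) := by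
      have e : P * P - P * N * P = P * (1 - N) * P := by noncomm_ring
      rw [e, ← hJN, Matrix.conjTranspose_mul Y P, hPh]
      noncomm_ring
    rw [this]
    exact hcomp.conjTranspose_mul_mul_same _

lemma rearr_sorted (x c : Fin d → ℝ) (hx : Antitone x) (hc : Antitone c) (hx0 : ∀ i, 0 ≤ x i)
    (hc0 : ∀ i, 0 ≤ c i) (S : Fin d → Fin d → ℝ) (hS : ∀ i j, 0 ≤ S i j)
    (hr : ∀ i, ∑ j, S i j ≤ 1) (hcol : ∀ j, ∑ i, S i j ≤ 1) :
    ∑ i, ∑ j, S i j * (x i * c j) ≤ ∑ i, x i * c i := by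
  set cc : ℕ → ℝ := fun k => if h : k < d then c ⟨k, h⟩ else 0 with hcc
  have hcc' : ∀ j : Fin d, c j = ∑ k : Fin d, if j ≤ k then cc k - cc (k + 1) else 0 := by
    intro j
    have h1 : ∑ k : Fin d, (if j ≤ k then cc k - cc (k + 1) else 0)
        = ∑ k ∈ Finset.range d, if (j : ℕ) ≤ k then cc k - cc (k + 1) else 0 := by
      rw [Finset.sum_range]
      rfl
    rw [h1, ← Finset.sum_filter]
    have h2 : (Finset.range d).filter (fun k => (j : ℕ) ≤ k) = Finset.Ico (j : ℕ) d := by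
      ext k; simp [and_comm]
    rw [h2, Finset.sum_Ico_eq_sum_range]
    have h3 := Finset.sum_range_sub' (fun k => cc (j + k)) (d - j)
    simp only [add_assoc] at h3 ⊢
    rw [h3]
    have : (j : ℕ) + (d - j) = d := by omega
    simp [hcc, this]
  have hδ : ∀ k : Fin d, 0 ≤ cc k - cc (k + 1) := by
    intro k
    rw [sub_nonneg]
    simp only [hcc, k.2, dif_pos]
    split_ifs with h
    · apply hc; exact Fin.mk_le_mk.mpr (Nat.le_succ _)
    · exact hc0 _
  have hk : ∀ k : Fin d, ∑ i, ∑ j, S i j * (x i * if j ≤ k then 1 else 0)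
      ≤ ∑ i, x i * if i ≤ k then 1 else 0 := by
    intro k
    set r : Fin d → ℝ := fun i => ∑ j, S i j * if j ≤ k then 1 else 0 with hrdef
    have hr0 : ∀ i, 0 ≤ r i := fun i => Finset.sum_nonneg fun j _ =>
      mul_nonneg (hS i j) (by split_ifs <;> simp)
    have hr1 : ∀ i, r i ≤ 1 := fun i => (Finset.sum_le_sum fun j _ => by
      split_ifs
      · simp
      · simpa using hS i j).trans (hr i)
    have hrs : ∑ i, r i ≤ ∑ i : Fin d, if i ≤ k then 1 else 0 := by
      rw [hrdef, Finset.sum_comm]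
      refine Finset.sum_le_sum fun j _ => ?_
      split_ifs
      · simpa using hcol j
      · simp
    have hL : ∑ i, ∑ j, S i j * (x i * if j ≤ k then 1 else 0) = ∑ i, x i * r i := by
      refine Finset.sum_congr rfl fun i _ => ?_
      rw [hrdef, Finset.mul_sum]
      refine Finset.sum_congr rfl fun j _ => ?_
      ring
    rw [hL]
    have h1 : ∑ i, (x i - x k) * r i ≤ ∑ i, (x i - x k) * if i ≤ k then 1 else 0 := by
      refine Finset.sum_le_sum fun i _ => ?_
      split_ifs with h
      · have := hx h
        nlinarith [hr1 i]
      · have := hx (not_le.mp h).le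
        nlinarith [hr0 i]
    have h2 := mul_le_mul_of_nonneg_left hrs (hx0 k)
    simp only [sub_mul, Finset.sum_sub_distrib, ← Finset.mul_sum] at h1
    linarith
  calc ∑ i, ∑ j, S i j * (x i * c j)
      = ∑ k : Fin d, (cc k - cc (k + 1)) * ∑ i, ∑ j, S i j * (x i * if j ≤ k then 1 else 0) := by
        simp only [Finset.mul_sum]
        symm
        rw [Finset.sum_comm]
        refine Finset.sum_congr rfl fun i _ => ?_
        rw [Finset.sum_comm]
        refine Finset.sum_congr rfl fun j _ => ?_
        rw [hcc' j, Finset.mul_sum, Finset.mul_sum]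
        refine Finset.sum_congr rfl fun k _ => ?_
        split_ifs <;> ring
    _ ≤ ∑ k : Fin d, (cc k - cc (k + 1)) * ∑ i, x i * if i ≤ k then 1 else 0 :=
        Finset.sum_le_sum fun k _ => mul_le_mul_of_nonneg_left (hk k) (hδ k)
    _ = ∑ i, x i * c i := by
        simp only [Finset.mul_sum]
        rw [Finset.sum_comm]
        refine Finset.sum_congr rfl fun i _ => ?_
        rw [hcc' i, Finset.mul_sum]
        refine Finset.sum_congr rfl fun k _ => ?_
        split_ifs <;> ring

lemma exists_antitone_perm (e : Fin d → ℝ) : ∃ s : Equiv.Perm (Fin d), Antitone (e ∘ s) := by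
  refine ⟨Tuple.sort (fun i => - e i), ?_⟩
  have := Tuple.monotone_sort (fun i => - e i)
  intro i j hij
  have := this hij
  simp only [Function.comp] at this ⊢
  linarith

lemma rearr (e c : Fin d → ℝ) (he0 : ∀ i, 0 ≤ e i) (hc0 : ∀ i, 0 ≤ c i) :
    ∃ s : Equiv.Perm (Fin d), ∀ f : ℝ → ℝ, MonotoneOn f (Set.Ici 0) → 0 ≤ f 0 →
      ∀ S : Fin d → Fin d → ℝ, (∀ i j, 0 ≤ S i j) → (∀ i, ∑ j, S i j ≤ 1) →
      (∀ j, ∑ i, S i j ≤ 1) →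
      ∑ i, ∑ j, S i j * (f (e i) * c j) ≤ ∑ i, f (e i) * c (s i) := by
  obtain ⟨s, hs⟩ := exists_antitone_perm e
  obtain ⟨t, ht⟩ := exists_antitone_perm c
  refine ⟨s.symm.trans t, fun f hf hf0 S hS hr hcol => ?_⟩
  have := rearr_sorted (fun i => f (e (s i))) (c ∘ t)
    (fun i j hij => hf (he0 _) (he0 _) (hs hij)) ht
    (fun i => hf0.trans (hf Set.self_mem_Ici (he0 _) (he0 _))) (fun i => hc0 _)
    (fun i j => S (s i) (t j)) (fun i j => hS _ _)
    (fun i => by rw [Equiv.sum_comp t (fun j => S (s i) j)]; exact hr _)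
    (fun j => by rw [Equiv.sum_comp s (fun i => S i (t j))]; exact hcol _)
  have e1 : ∑ i, ∑ j, S i j * (f (e i) * c j)
      = ∑ i, ∑ j, S (s i) (t j) * (f (e (s i)) * c (t j)) := by
    rw [← Equiv.sum_comp s]
    refine Finset.sum_congr rfl fun i _ => ?_
    rw [← Equiv.sum_comp t]
  have e2 : ∑ i, f (e i) * c ((s.symm.trans t) i) = ∑ i, f (e (s i)) * c (t i) := by
    rw [← Equiv.sum_comp s]
    simp
  rw [e1, e2]
  exact this

lemma key_ineq {A₁ A₀ E : Matrix (Fin d) (Fin d) ℂ} {Z : Matrix (Fin d) (Fin d) ℂ}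
    {e c : Fin d → ℝ} {b : ℝ} (hb0 : 0 < b) (hb1 : b ≤ 1) (hV : Vᴴ * V = 1) (hZ : Zᴴ * Z = 1)
    (hA₁ : A₁.PosSemidef) (hA₀ : A₀.PosSemidef) (he : ∀ i, 0 ≤ e i) (hc : ∀ i, 0 ≤ c i)
    (hE : E = spec V e) (hle : (A₀ + E - A₁).PosSemidef) :
    ∃ s : Equiv.Perm (Fin d),
    (matRpow A₁ b * spec Z c).trace.re - (matRpow A₀ b * spec Z c).trace.re
      ≤ ∑ i, e i ^ b * c (s i) := by
  obtain ⟨s, hs⟩ := rearr e c he hc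
  refine ⟨s, ?_⟩
  have hEp : E.PosSemidef := hE ▸ spec_psd he
  have hCp : (spec Z c).PosSemidef := spec_psd hc
  obtain ⟨U₁, a₁, hU₁, ha₁, hA₁s, hA₁r⟩ := exists_spec hA₁
  obtain ⟨U₀, a₀, hU₀, ha₀, hA₀s, hA₀r⟩ := exists_spec hA₀
  obtain ⟨W, w, hW, hw, hWs, -⟩ := exists_spec (hA₀.add hEp)
  -- bound through a contraction
  have hcontr : ∀ (K : Matrix (Fin d) (Fin d) ℂ) (f : ℝ → ℝ), Contr K →
      MonotoneOn f (Set.Ici 0) → 0 ≤ f 0 →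
      (Kᴴ * spec V (fun i => f (e i)) * K * spec Z c).trace.re ≤ ∑ i, f (e i) * c (s i) := by
    intro K f hK hf hf0
    rw [trace_form]
    have hL : Contr (Vᴴ * K * Z) := ((contr_unitary hV).conj.mul hK).mul (contr_unitary hZ)
    exact hs f hf hf0 (fun i j => Complex.normSq ((Vᴴ * K * Z) i j)) (fun i j => Complex.normSq_nonneg _)
      hL.row hL.col
  rw [hA₁r, hA₀r]
  rcases hb1.lt_or_eq with hb1 | rfl
  · have hb : b ∈ Set.Ioo (0 : ℝ) 1 := ⟨hb0, hb1⟩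
    set κ := ∫ t in Set.Ioi (0 : ℝ), Real.rpowIntegrand₀₁ b t 1 with hκ
    have hκpos : 0 < κ := by
      refine lt_of_lt_of_le ?_ (Real.le_integral_rpowIntegrand₀₁_one hb)
      apply div_pos_of_neg_of_neg <;> linarith
    have hint : ∀ (x m : Fin d → ℝ), (∀ i, 0 ≤ x i) →
        MeasureTheory.IntegrableOn (fun t => ∑ i, Real.rpowIntegrand₀₁ b t (x i) * m i) (Set.Ioi 0) ∧
        ∫ t in Set.Ioi (0 : ℝ), ∑ i, Real.rpowIntegrand₀₁ b t (x i) * m i = κ * ∑ i, x i ^ b * m i := by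
      intro x m hx
      have hi : ∀ i ∈ Finset.univ, MeasureTheory.IntegrableOn (fun t => Real.rpowIntegrand₀₁ b t (x i) * m i) (Set.Ioi 0) :=
        fun i _ => (Real.integrableOn_rpowIntegrand₀₁_Ioi hb (hx i)).mul_const _
      refine ⟨MeasureTheory.integrable_finsetSum _ hi, ?_⟩
      rw [MeasureTheory.integral_finsetSum _ hi, Finset.mul_sum]
      refine Finset.sum_congr rfl fun i _ => ?_
      rw [MeasureTheory.integral_mul_const, Real.integral_rpowIntegrand₀₁_eq_rpow_mul_const hb (hx i)]
      ring
    rw [trace_spec_mul_re, trace_spec_mul_re]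
    set m₁ : Fin d → ℝ := fun i => ((U₁ᴴ * spec Z c * U₁) i i).re with hm₁
    set m₀ : Fin d → ℝ := fun i => ((U₀ᴴ * spec Z c * U₀) i i).re with hm₀
    obtain ⟨i1, v1⟩ := hint a₁ m₁ ha₁
    obtain ⟨i0, v0⟩ := hint a₀ m₀ ha₀
    obtain ⟨ie, ve⟩ := hint e (fun i => c (s i)) he
    have hmono : ∫ t in Set.Ioi (0 : ℝ), (∑ i, Real.rpowIntegrand₀₁ b t (a₁ i) * m₁ i
        - ∑ i, Real.rpowIntegrand₀₁ b t (a₀ i) * m₀ i)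
        ≤ ∫ t in Set.Ioi (0 : ℝ), ∑ i, Real.rpowIntegrand₀₁ b t (e i) * c (s i) := by
      refine MeasureTheory.setIntegral_mono_on (i1.sub i0) ie measurableSet_Ioi fun t ht => ?_
      have ht : 0 < t := ht
      obtain ⟨K, hK, hKp⟩ := resolvent_contr ht hU₀ hV hW ha₀ he hw hA₀s hE hWs
      have hanti : (spec U₁ (fun i => (t + a₁ i)⁻¹) - spec W (fun i => (t + w i)⁻¹)).PosSemidef := by
        refine inv_antitone (X := t • 1 + A₁) (Y := t • 1 + (A₀ + E))
          (spec_psd fun i => by have := ha₁ i; positivity) (spec_herm _) ?_ ?_ ?_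
        · rw [hA₁s, ← spec_one hU₁, spec_smul, spec_add, spec_mul hU₁]
          congr 1; ext i
          have := ha₁ i
          rw [mul_one]
          exact mul_inv_cancel₀ (by positivity)
        · rw [hWs, ← spec_one hW, spec_smul, spec_add, spec_mul hW]
          congr 1; ext i
          have := hw i
          rw [mul_one]
          exact mul_inv_cancel₀ (by positivity)
        · convert hle using 1
          abel
      have h1 := trace_mul_mono (hKp.add hanti |> fun h => (by
        convert h using 1
        abel_nf : (Kᴴ * spec V (fun i => t⁻¹ - (t + e i)⁻¹) * K -
          (spec U₀ (fun i => (t + a₀ i)⁻¹) - spec U₁ (fun i => (t + a₁ i)⁻¹))).PosSemidef)) hCp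
      have h2 := hcontr K (fun x => t⁻¹ - (t + x)⁻¹) hK (by
        intro x hx y hy hxy
        have hx : 0 ≤ x := hx
        have : (t + y)⁻¹ ≤ (t + x)⁻¹ := by gcongr
        simp only
        linarith) (by simp)
      have h3 := h1.trans h2
      rw [Matrix.sub_mul, Matrix.trace_sub, Complex.sub_re, trace_spec_mul_re, trace_spec_mul_re] at h3
      have tr : ∀ (U : Matrix (Fin d) (Fin d) ℂ) (a : Fin d → ℝ), Uᴴ * U = 1 →
          ∑ i, Real.rpowIntegrand₀₁ b t (a i) * ((Uᴴ * spec Z c * U) i i).re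
          = t ^ b * (t⁻¹ * (spec Z c).trace.re
            - ∑ i, (t + a i)⁻¹ * ((Uᴴ * spec Z c * U) i i).re) := by
        intro U a hU
        have h4 : (spec Z c).trace.re = ∑ i, ((Uᴴ * spec Z c * U) i i).re := by
          have := trace_spec_mul_re (V := U) (fun _ => 1) (spec Z c)
          rw [spec_one hU] at this
          simpa using this
        rw [h4, Finset.mul_sum, ← Finset.sum_sub_distrib, Finset.mul_sum]
        refine Finset.sum_congr rfl fun i _ => ?_
        unfold Real.rpowIntegrand₀₁
        ring
      simp only [hm₁, hm₀]
      rw [tr U₁ a₁ hU₁, tr U₀ a₀ hU₀]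
      have h5 : ∑ i, Real.rpowIntegrand₀₁ b t (e i) * c (s i)
          = t ^ b * ∑ i, (t⁻¹ - (t + e i)⁻¹) * c (s i) := by
        rw [Finset.mul_sum]
        refine Finset.sum_congr rfl fun i _ => ?_
        unfold Real.rpowIntegrand₀₁
        ring
      rw [h5, ← mul_sub]
      refine mul_le_mul_of_nonneg_left ?_ (by positivity)
      refine le_trans (le_of_eq ?_) h3
      ring
    rw [MeasureTheory.integral_sub i1 i0, v1, v0, ve, ← mul_sub] at hmono
    exact le_of_mul_le_mul_left hmono hκpos
  · simp only [Real.rpow_one]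
    rw [← hA₁s, ← hA₀s]
    have h1 : (A₁ * spec Z c).trace.re ≤ ((A₀ + E) * spec Z c).trace.re := trace_mul_mono hle hCp
    rw [Matrix.add_mul, Matrix.trace_add, Complex.add_re] at h1
    have h2 := hcontr 1 (fun x => x) ⟨by simpa using Matrix.PosSemidef.zero, by simpa using Matrix.PosSemidef.zero⟩
      (fun x _ y _ h => h) le_rfl
    simp only [Matrix.conjTranspose_one, Matrix.one_mul, Matrix.mul_one] at h2
    rw [← hE] at h2
    linarith

lemma diag_spec_re {Z : Matrix (Fin d) (Fin d) ℂ} (c : Fin d → ℝ) (i : Fin d) :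
    ((Vᴴ * spec Z c * V) i i).re = ∑ j, Complex.normSq ((Vᴴ * Z) i j) * c j := by
  have h2 : Vᴴ * spec Z c * V
      = (Vᴴ * Z) * diagonal (fun i => ((c i : ℝ) : ℂ)) * (Vᴴ * Z)ᴴ := by
    unfold spec
    simp only [Matrix.conjTranspose_mul, Matrix.conjTranspose_conjTranspose, Matrix.mul_assoc]
  rw [h2]
  generalize Vᴴ * Z = L
  rw [Matrix.mul_apply, Complex.re_sum]
  refine Finset.sum_congr rfl fun j _ => ?_
  rw [Matrix.mul_diagonal, Matrix.conjTranspose_apply]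
  simp [Complex.normSq_apply]
  ring

lemma unitary_row (hV : Vᴴ * V = 1) (i : Fin d) : ∑ j, Complex.normSq (V i j) = 1 := by
  have h2 : V * Vᴴ = 1 := mul_eq_one_comm.mp hV
  have := congrArg Complex.re (congrFun (congrFun h2 i) i)
  rw [Matrix.mul_apply] at this
  simpa [Complex.normSq_apply] using this

lemma sum_rpow_le_one {n : ℕ} {Z : Fin n → Matrix (Fin d) (Fin d) ℂ} {c : Fin n → Fin d → ℝ}
    {e : Fin d → ℝ} {t : Fin n → ℝ} {r : ℝ} (hr : 1 ≤ r) (hV : Vᴴ * V = 1)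
    (hZ : ∀ k, (Z k)ᴴ * Z k = 1) (hc : ∀ k i, 0 ≤ c k i) (hcs : ∀ k, ∑ i, c k i ^ r = 1)
    (ht : ∀ k, 0 ≤ t k) (hts : ∑ k, t k = 1) (h : ∑ k, t k • spec (Z k) (c k) = spec V e) :
    ∑ i, e i ^ r ≤ 1 := by
  have hu : ∀ k, (Vᴴ * Z k)ᴴ * (Vᴴ * Z k) = 1 := by
    intro k
    have h2 : V * Vᴴ = 1 := mul_eq_one_comm.mp hV
    have : (Vᴴ * Z k)ᴴ * (Vᴴ * Z k) = (Z k)ᴴ * (V * Vᴴ) * Z k := by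
      simp only [Matrix.conjTranspose_mul, Matrix.conjTranspose_conjTranspose, Matrix.mul_assoc]
    rw [this, h2, Matrix.mul_one, hZ]
  have hei : ∀ i, e i = ∑ k, t k * ∑ j, Complex.normSq ((Vᴴ * Z k) i j) * c k j := by
    intro i
    have h1 : ((Vᴴ * spec V e * V) i i).re = e i := by
      have : Vᴴ * spec V e * V = (Vᴴ * V) * diagonal (fun i => ((e i : ℝ) : ℂ)) * (Vᴴ * V) := by
        unfold spec; simp only [Matrix.mul_assoc]
      rw [this, hV]; simp
    rw [← h1, ← h, Matrix.mul_sum, Matrix.sum_mul, Matrix.sum_apply, Complex.re_sum]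
    refine Finset.sum_congr rfl fun k _ => ?_
    rw [← diag_spec_re, Matrix.mul_smul, Matrix.smul_mul, Matrix.smul_apply, Complex.smul_re, smul_eq_mul]
  calc ∑ i, e i ^ r ≤ ∑ i, ∑ k, t k * ∑ j, Complex.normSq ((Vᴴ * Z k) i j) * c k j ^ r := by
        refine Finset.sum_le_sum fun i _ => ?_
        rw [hei i]
        refine (Real.rpow_arith_mean_le_arith_mean_rpow _ _ _ (fun k _ => ht k) hts
          (fun k _ => Finset.sum_nonneg fun j _ => mul_nonneg (Complex.normSq_nonneg _) (hc k j)) hr).trans ?_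
        refine Finset.sum_le_sum fun k _ => mul_le_mul_of_nonneg_left ?_ (ht k)
        exact Real.rpow_arith_mean_le_arith_mean_rpow _ _ _ (fun j _ => Complex.normSq_nonneg _)
          (unitary_row (hu k) i) (fun j _ => hc k j) hr
    _ = ∑ k, t k * ∑ j, (∑ i, Complex.normSq ((Vᴴ * Z k) i j)) * c k j ^ r := by
        rw [Finset.sum_comm]
        refine Finset.sum_congr rfl fun k _ => ?_
        rw [← Finset.mul_sum, Finset.sum_comm]
        simp only [Finset.sum_mul]
    _ ≤ ∑ k, t k * ∑ j, 1 * c k j ^ r := by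
        refine Finset.sum_le_sum fun k _ => mul_le_mul_of_nonneg_left ?_ (ht k)
        refine Finset.sum_le_sum fun j _ => mul_le_mul_of_nonneg_right ?_ (Real.rpow_nonneg (hc k j) _)
        exact (contr_unitary (hu k)).col j
    _ = 1 := by simp [hcs, hts]

lemma diff_le {n : ℕ} (α : ℝ) (h1 : 1 / 2 ≤ α) (h2 : α < 1)
    (W : Fin n → Matrix (Fin d) (Fin d) ℂ)
    (hW : ∀ j, (W j).PosSemidef ∧ (W j).trace = 1)
    (p q : Fin n → ℝ) (hp : ∀ k, 0 ≤ p k) (hq : ∀ k, 0 ≤ q k) (j : Fin n) :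
    ((matRpow (∑ k, p k • matRpow (W k) α) ((1 - α) / α) * matRpow (W j) α).trace).re
      - ((matRpow (∑ k, q k • matRpow (W k) α) ((1 - α) / α) * matRpow (W j) α).trace).re
      ≤ (∑ k, |p k - q k|) ^ ((1 - α) / α) := by
  have h0 : 0 < α := by linarith
  have hβ0 : 0 < (1 - α) / α := div_pos (by linarith) h0
  have hβ1 : (1 - α) / α ≤ 1 := by rw [div_le_one h0]; linarith
  set τ := ∑ k, |p k - q k| with hτ
  have hτ0 : 0 ≤ τ := Finset.sum_nonneg fun k _ => abs_nonneg _
  rcases hτ0.eq_or_lt with hz | hτpos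
  · have hpq : p = q := by
      ext k
      have := (Finset.sum_eq_zero_iff_of_nonneg (fun k _ => abs_nonneg (p k - q k))).mp hz.symm k (Finset.mem_univ k)
      linarith [abs_eq_zero.mp this]
    rw [hpq, sub_self]
    positivity
  choose Z w hZ hw hWs hWr using fun k => exists_spec (hW k).1
  set β := (1 - α) / α with hβ
  set c : Fin n → Fin d → ℝ := fun k i => w k i ^ α with hc
  have hc0 : ∀ k i, 0 ≤ c k i := fun k i => Real.rpow_nonneg (hw k i) _
  have hB : ∀ k, matRpow (W k) α = spec (Z k) (c k) := fun k => hWr k α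
  have hcs : ∀ k, ∑ i, c k i ^ (1 + β) = 1 := by
    intro k
    have : ∀ i, c k i ^ (1 + β) = w k i := by
      intro i
      simp only [hc]
      rw [← Real.rpow_mul (hw k i)]
      have : α * (1 + β) = 1 := by rw [hβ]; field_simp; ring
      rw [this, Real.rpow_one]
    simp only [this]
    have h3 := trace_spec_re (hZ k) (w k)
    rw [← hWs k, (hW k).2] at h3
    simpa using h3.symm
  simp only [hB]
  have hsum : ∀ t : Fin n → ℝ, (∀ k, 0 ≤ t k) → (∑ k, t k • spec (Z k) (c k)).PosSemidef :=
    fun t ht => Matrix.posSemidef_sum _ fun k _ => psd_smul (spec_psd (hc0 k)) (ht k)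
  set t : Fin n → ℝ := fun k => |p k - q k| / τ with ht
  have ht0 : ∀ k, 0 ≤ t k := fun k => div_nonneg (abs_nonneg _) hτ0
  have hts : ∑ k, t k = 1 := by
    rw [ht, ← Finset.sum_div]; exact div_self hτpos.ne'
  obtain ⟨V, e, hV, he, hVs, -⟩ := exists_spec (hsum t ht0)
  have hes := sum_rpow_le_one (r := 1 + β) (by linarith) hV hZ hc0 hcs ht0 hts hVs
  obtain ⟨s, hs⟩ := key_ineq (E := spec V (fun i => τ * e i)) hβ0 hβ1 hV (hZ j) (hsum p hp) (hsum q hq)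
    (fun i => mul_nonneg hτ0 (he i)) (hc0 j) rfl (by
      rw [← spec_smul, ← hVs, Finset.smul_sum, ← Finset.sum_add_distrib, ← Finset.sum_sub_distrib]
      refine Matrix.posSemidef_sum _ fun k _ => ?_
      rw [smul_smul, ← add_smul, ← sub_smul]
      refine psd_smul (spec_psd (hc0 k)) ?_
      simp only [ht]
      rw [mul_div_cancel₀ _ hτpos.ne']
      linarith [le_abs_self (p k - q k)])
  refine hs.trans ?_
  have hy : ∑ i, e i ^ β * c j (s i) ≤ 1 := by
    have hpq : Real.HolderConjugate ((1 + β) / β) (1 + β) := by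
      rw [Real.holderConjugate_iff]
      constructor
      · rw [one_lt_div hβ0]; linarith
      · field_simp
        ring
    calc ∑ i, e i ^ β * c j (s i)
        ≤ ∑ i, ((e i ^ β) ^ ((1 + β) / β) / ((1 + β) / β) + c j (s i) ^ (1 + β) / (1 + β)) :=
          Finset.sum_le_sum fun i _ => Real.young_inequality_of_nonneg (Real.rpow_nonneg (he i) _) (hc0 _ _) hpq
      _ = (∑ i, e i ^ (1 + β)) / ((1 + β) / β) + (∑ i, c j i ^ (1 + β)) / (1 + β) := by
          rw [Finset.sum_add_distrib, ← Finset.sum_div, ← Finset.sum_div,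
            Equiv.sum_comp s (fun i => c j i ^ (1 + β))]
          congr 2
          refine Finset.sum_congr rfl fun i _ => ?_
          rw [← Real.rpow_mul (he i)]
          congr 1
          field_simp
      _ ≤ 1 / ((1 + β) / β) + 1 / (1 + β) := by
          rw [hcs]
          gcongr
      _ = 1 := by field_simp; ring
  calc ∑ i, (τ * e i) ^ β * c j (s i) = τ ^ β * ∑ i, e i ^ β * c j (s i) := by
        rw [Finset.mul_sum]
        refine Finset.sum_congr rfl fun i _ => ?_
        rw [Real.mul_rpow hτ0 (he i)]; ring
    _ ≤ τ ^ β * 1 := by gcongr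
    _ = τ ^ β := mul_one _

end HS

/-- coordinate-wise ℓ₂ Hölder-smoothness bound for
`g̃_α(p) = Tr[(∑ⱼ p[j] W(j)^α)^{1/α}]`. -/
theorem holder_smooth_coordinatewise_l2 {n d : ℕ} (hn : 0 < n) (hd : 0 < d) (α : ℝ)
    (hα : α ∈ Set.Ico (1 / 2 : ℝ) 1)
    (W : Fin n → Matrix (Fin d) (Fin d) ℂ)
    (hW : ∀ j, (W j).PosSemidef ∧ (W j).trace = 1)
    (p q : Fin n → ℝ) (hp : p ∈ stdSimplex ℝ (Fin n)) (hq : q ∈ stdSimplex ℝ (Fin n)) :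
    Real.sqrt (∑ j,
        ((1 / α) * (((matRpow (∑ k, p k • matRpow (W k) α) ((1 - α) / α)
              * matRpow (W j) α).trace).re
            - ((matRpow (∑ k, q k • matRpow (W k) α) ((1 - α) / α)
              * matRpow (W j) α).trace).re)) ^ 2)
      ≤ ((n : ℝ) ^ (1 / (2 * α)) / α) * (∑ k, (p k - q k) ^ 2) ^ ((1 - α) / (2 * α)) := by
  obtain ⟨h1, h2⟩ := hα
  have h0 : 0 < α := by linarith
  set β := (1 - α) / α with hβ
  have hβ0 : 0 < β := div_pos (by linarith) h0
  set τ := ∑ k, |p k - q k| with hτ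
  have hτ0 : 0 ≤ τ := Finset.sum_nonneg fun k _ => abs_nonneg _
  set D := ∑ k, (p k - q k) ^ 2 with hD
  have hD0 : 0 ≤ D := Finset.sum_nonneg fun k _ => sq_nonneg _
  have hτD : τ ≤ √(n * D) := by
    apply Real.le_sqrt_of_sq_le
    have := sq_sum_le_card_mul_sum_sq (s := (Finset.univ : Finset (Fin n))) (f := fun k => |p k - q k|)
    simpa [sq_abs] using this
  have hj : ∀ j, ((1 / α) * (((matRpow (∑ k, p k • matRpow (W k) α) β
              * matRpow (W j) α).trace).re
            - ((matRpow (∑ k, q k • matRpow (W k) α) β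
              * matRpow (W j) α).trace).re)) ^ 2 ≤ ((1 / α) * τ ^ β) ^ 2 := by
    intro j
    have a1 := HS.diff_le α h1 h2 W hW p q hp.1 hq.1 j
    have a2 := HS.diff_le α h1 h2 W hW q p hq.1 hp.1 j
    have e : ∑ k, |q k - p k| = τ := Finset.sum_congr rfl fun k _ => abs_sub_comm _ _
    rw [e] at a2
    rw [mul_pow, mul_pow]
    refine mul_le_mul_of_nonneg_left ?_ (sq_nonneg _)
    apply sq_le_sq'
    · linarith
    · exact a1
  have hn0 : (0 : ℝ) ≤ n := Nat.cast_nonneg n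
  calc _ ≤ √(∑ j : Fin n, ((1 / α) * τ ^ β) ^ 2) := Real.sqrt_le_sqrt (Finset.sum_le_sum fun j _ => hj j)
    _ = √n * ((1 / α) * τ ^ β) := by
      rw [Finset.sum_const, Finset.card_univ, Fintype.card_fin, nsmul_eq_mul, Real.sqrt_mul hn0,
        Real.sqrt_sq (by positivity)]
    _ ≤ √n * ((1 / α) * √(n * D) ^ β) := by gcongr
    _ = _ := by
      rw [Real.sqrt_mul hn0, Real.mul_rpow (Real.sqrt_nonneg _) (Real.sqrt_nonneg _),
        Real.sqrt_eq_rpow, Real.sqrt_eq_rpow, ← Real.rpow_mul hn0, ← Real.rpow_mul hD0]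
      have e1 : 1 / (2 * α) = 1 / 2 + 1 / 2 * β := by rw [hβ]; field_simp; ring
      have e2 : (1 - α) / (2 * α) = 1 / 2 * β := by rw [hβ]; field_simp
      have hnp : (0 : ℝ) < n := Nat.cast_pos.mpr hn
      rw [e1, e2, Real.rpow_add hnp]
      ring
end

section
/- Let α ∈ (1/2, 1) ∪ (1, ∞), let p ∈ Δ_n satisfy p[j] > 0 for all j, and assume Σ_{j=1}^n p[j] W(j)^α is positive definite. Define F(Q) := (Σ_{j=1}^n p[j] W(j)^α / Tr[W(j)^α Q^{1−α}])^{1/α} on positive definite matrices, let Q* be a positive definite matrix with F(Q*) = Q*, let Q_1 be positive definite, and set Q_{t+1} := F(Q_t) for t ≥ 1. Then for every T ≥ 1 and every j ∈ {1,…,n}, |D_α(W(j)‖Q_{T+1}) − D_α(W(j)‖Q*)| ≤ (1/|1−α|) · (|1−α|/α)^T · d_T(Q_1^{1−α}, (Q*)^{1−α}). -/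
open Matrix
open scoped ComplexOrder

/-- Loewner order: `A ⪯ B` iff `B - A` is positive semidefinite. -/
def loewnerLE {d : ℕ} (A B : Matrix (Fin d) (Fin d) ℂ) : Prop := (B - A).PosSemidef

/-- Thompson metric on positive definite matrices. -/
noncomputable def thompsonDist {d : ℕ} (V U : Matrix (Fin d) (Fin d) ℂ) : ℝ :=
  sInf {r : ℝ | 0 ≤ r ∧ loewnerLE (Real.exp (-r) • V) U ∧ loewnerLE U (Real.exp r • V)}

/-- Petz–Rényi divergence `D_α(A‖Q) = (1/(α-1)) log Tr[A^α Q^{1-α}]`. -/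
noncomputable def petzRenyiDiv {d : ℕ} (α : ℝ) (A Q : Matrix (Fin d) (Fin d) ℂ) : ℝ :=
  (1 / (α - 1)) * Real.log ((matRpow A α * matRpow Q (1 - α)).trace).re

/-- The fixed-point map `F(Q) = (∑ⱼ p[j] W(j)^α / Tr[W(j)^α Q^{1-α}])^{1/α}`. -/
noncomputable def augFixedPointMap {n d : ℕ} (α : ℝ) (W : Fin n → Matrix (Fin d) (Fin d) ℂ)
    (p : Fin n → ℝ) (Q : Matrix (Fin d) (Fin d) ℂ) : Matrix (Fin d) (Fin d) ℂ :=
  matRpow (∑ j, (p j / ((matRpow (W j) α * matRpow Q (1 - α)).trace).re) • matRpow (W j) α)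
    (1 / α)

section AuxAbstract

variable {A : Type*} [CStarAlgebra A] [PartialOrder A] [StarOrderedRing A]

lemma aux_smul_sp {a : A} (ha : IsStrictlyPositive a) {c : ℝ} (hc : 0 < c) :
    IsStrictlyPositive (c • a) := by
  rw [IsStrictlyPositive.iff_of_unital] at ha ⊢
  refine ⟨smul_nonneg hc.le ha.1, ?_⟩
  have := (Units.mk0 c hc.ne').isUnit
  exact ha.2.smul (Units.mk0 c hc.ne')

lemma aux_smul_rpow {a : A} (ha : IsStrictlyPositive a) {c : ℝ} (hc : 0 < c) (s : ℝ) :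
    (c • a) ^ s = (c ^ s) • a ^ s := by
  have h0 : (0 : A) ≤ a := ha.nonneg
  have hspec : ∀ x ∈ spectrum ℝ a, 0 < x := fun x hx => by
    exact (CStarAlgebra.isStrictlyPositive_iff_isSelfAdjoint_and_spectrum_pos.mp ha).2 x hx
  have hcont : ContinuousOn (fun x : ℝ => x ^ s) (spectrum ℝ a) :=
    fun x hx => (Real.continuousAt_rpow_const x s (Or.inl (hspec x hx).ne')).continuousWithinAt
  have hca : c • a = cfc (fun x : ℝ => c * x) a := by
    have := cfc_const_mul_id c a
    simpa using this.symm
  rw [CFC.rpow_eq_cfc_real (smul_nonneg hc.le h0), CFC.rpow_eq_cfc_real h0, ← cfc_smul _ _ _ hcont]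
  rw [hca, ← cfc_comp (fun x : ℝ => x ^ s) (fun x : ℝ => c * x) a (by cfc_tac) ?_ (by fun_prop)]
  · refine cfc_congr fun x hx => ?_
    simp [Real.mul_rpow hc.le (hspec x hx).le]
  · rintro _ ⟨x, hx, rfl⟩
    exact (Real.continuousAt_rpow_const _ s (Or.inl
      (mul_pos hc (hspec x hx)).ne')).continuousWithinAt

lemma aux_rpow_anti {a b : A} (ha : IsStrictlyPositive a) (hab : a ≤ b) {s : ℝ}
    (hs : s ∈ Set.Icc (-1 : ℝ) 0) : b ^ s ≤ a ^ s := by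
  have hb : IsStrictlyPositive b := ha.of_le hab
  rcases eq_or_lt_of_le hs.2 with h | h
  · subst h; rw [CFC.rpow_zero a ha.nonneg, CFC.rpow_zero b hb.nonneg]
  have h1 : a ^ (-s) ≤ b ^ (-s) := CFC.rpow_le_rpow ⟨by linarith, by linarith [hs.1]⟩ hab
  have h2 := CStarAlgebra.rpow_neg_one_le_rpow_neg_one h1 (ha.rpow a (-s))
  rw [CFC.rpow_rpow a _ _ (by linarith) ha,
    CFC.rpow_rpow b _ _ (by linarith) hb] at h2
  simpa using h2

lemma aux_one_side {a b : A} (ha : IsStrictlyPositive a) (hb : IsStrictlyPositive b)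
    {r s : ℝ} (hs : |s| ≤ 1) (h1 : Real.exp (-r) • b ≤ a) (h2 : a ≤ Real.exp r • b) :
    Real.exp (-(|s| * r)) • b ^ s ≤ a ^ s ∧ a ^ s ≤ Real.exp (|s| * r) • b ^ s := by
  rw [abs_le] at hs
  have e1 := aux_smul_rpow hb (Real.exp_pos (-r)) s
  have e2 := aux_smul_rpow hb (Real.exp_pos r) s
  rw [← Real.exp_mul] at e1 e2
  rcases le_total 0 s with h | h
  · rw [abs_of_nonneg h]
    have k1 := CFC.rpow_le_rpow ⟨h, hs.2⟩ h1
    have k2 := CFC.rpow_le_rpow ⟨h, hs.2⟩ h2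
    rw [e1] at k1
    rw [e2] at k2
    constructor
    · convert k1 using 3; ring
    · convert k2 using 3; ring
  · rw [abs_of_nonpos h]
    have k1 := aux_rpow_anti (aux_smul_sp hb (Real.exp_pos (-r))) h1 ⟨hs.1, h⟩
    have k2 := aux_rpow_anti ha h2 ⟨hs.1, h⟩
    rw [e1] at k1
    rw [e2] at k2
    constructor
    · convert k2 using 3; ring
    · convert k1 using 3; ring

lemma aux_dom {a b : A} (ha : IsStrictlyPositive a) (hb : 0 ≤ b) :
    ∃ c : ℝ, 0 < c ∧ b ≤ c • a := by
  rcases subsingleton_or_nontrivial A with hsub | hnon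
  · exact ⟨1, one_pos, le_of_eq (Subsingleton.elim _ _)⟩
  have : ∃ e : ℝ, 0 < e ∧ algebraMap ℝ A e ≤ a := by
    rw [CFC.exists_pos_algebraMap_le_iff ha.nonneg.isSelfAdjoint]
    exact (CStarAlgebra.isStrictlyPositive_iff_isSelfAdjoint_and_spectrum_pos.mp ha).2
  obtain ⟨e, he, hea⟩ := this
  refine ⟨(‖b‖ + 1) / e, by positivity, ?_⟩
  have h1 : b ≤ algebraMap ℝ A ‖b‖ := hb.isSelfAdjoint.le_algebraMap_norm_self
  have h2 : algebraMap ℝ A ‖b‖ ≤ algebraMap ℝ A (‖b‖ + 1) := algebraMap_mono A (by linarith)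
  refine h1.trans (h2.trans ?_)
  have h3 := smul_le_smul_of_nonneg_left hea (show 0 ≤ (‖b‖ + 1) / e by positivity)
  refine le_trans (le_of_eq ?_) h3
  rw [Algebra.algebraMap_eq_smul_one, Algebra.algebraMap_eq_smul_one, smul_smul]
  congr 1
  field_simp

lemma aux_nonempty {a b : A} (ha : IsStrictlyPositive a) (hb : IsStrictlyPositive b) :
    ∃ r : ℝ, 0 ≤ r ∧ Real.exp (-r) • a ≤ b ∧ b ≤ Real.exp r • a := by
  obtain ⟨c, hc, h1⟩ := aux_dom ha hb.nonneg
  obtain ⟨c', hc', h2⟩ := aux_dom hb ha.nonneg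
  refine ⟨max 0 (max (Real.log c) (Real.log c')), le_max_left _ _, ?_, ?_⟩
  · set r := max 0 (max (Real.log c) (Real.log c'))
    have h : c' ≤ Real.exp r := by
      rw [← Real.log_le_iff_le_exp hc']
      exact (le_max_right _ _).trans (le_max_right _ _)
    have h3 : a ≤ Real.exp r • b := h2.trans (smul_le_smul_of_nonneg_right h hb.nonneg)
    have h4 := smul_le_smul_of_nonneg_left h3 (Real.exp_pos (-r)).le
    rwa [smul_smul, ← Real.exp_add, neg_add_cancel, Real.exp_zero, one_smul] at h4
  · refine h1.trans (smul_le_smul_of_nonneg_right ?_ ha.nonneg)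
    rw [← Real.log_le_iff_le_exp hc]
    exact (le_max_left _ _).trans (le_max_right _ _)

end AuxAbstract

section AuxMatrix

open scoped Matrix.Norms.L2Operator MatrixOrder

variable {d : ℕ}

lemma aux_matRpow {M : Matrix (Fin d) (Fin d) ℂ} (hM : M.PosSemidef) (r : ℝ) :
    matRpow M r = M ^ r := by
  have h0 : 0 ≤ M := Matrix.nonneg_iff_posSemidef.mpr hM
  rw [CFC.rpow_eq_cfc_real h0, hM.1.cfc_eq, matRpow, dif_pos hM.1, Matrix.IsHermitian.cfc,
    Unitary.conjStarAlgAut_apply]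
  rfl

lemma aux_trace_nonneg {M N : Matrix (Fin d) (Fin d) ℂ} (hM : M.PosSemidef) (hN : N.PosSemidef) :
    0 ≤ ((M * N).trace).re := by
  have h0 : 0 ≤ M := Matrix.nonneg_iff_posSemidef.mpr hM
  have hs : (CFC.sqrt M).IsHermitian := (Matrix.nonneg_iff_posSemidef.mp (CFC.sqrt_nonneg M)).1
  have h1 : (M * N).trace = (CFC.sqrt M * N * (CFC.sqrt M)ᴴ).trace := by
    rw [hs.eq, Matrix.trace_mul_comm (CFC.sqrt M * N), ← mul_assoc, CFC.sqrt_mul_sqrt_self M h0]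
  rw [h1]
  have := (hN.mul_mul_conjTranspose_same (CFC.sqrt M)).trace_nonneg
  exact (Complex.le_def.mp this).1

lemma aux_trace_mono {M U V : Matrix (Fin d) (Fin d) ℂ} (hM : M.PosSemidef) (h : U ≤ V) :
    ((M * U).trace).re ≤ ((M * V).trace).re := by
  have := aux_trace_nonneg hM (Matrix.le_iff.mp h)
  rw [mul_sub, Matrix.trace_sub, Complex.sub_re] at this
  linarith

lemma aux_trace_smul (M U : Matrix (Fin d) (Fin d) ℂ) (c : ℝ) :
    ((M * (c • U)).trace).re = c * ((M * U).trace).re := by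
  rw [Matrix.mul_smul, Matrix.trace_smul, Complex.smul_re, smul_eq_mul]

lemma aux_trace_pos {M V : Matrix (Fin d) (Fin d) ℂ} (hM : M.PosSemidef) (hM0 : M ≠ 0)
    (hV : V.PosDef) : 0 < ((M * V).trace).re := by
  obtain ⟨c, hc, h⟩ := aux_dom (Matrix.isStrictlyPositive_iff_posDef.mpr hV)
    (show (0 : Matrix (Fin d) (Fin d) ℂ) ≤ 1 from
      Matrix.nonneg_iff_posSemidef.mpr Matrix.PosSemidef.one)
  have h1 := aux_trace_mono hM h
  rw [aux_trace_smul, mul_one] at h1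
  have h2 : M.trace ≠ 0 := fun h => hM0 (hM.trace_eq_zero_iff.mp h)
  have h3 : 0 < M.trace := lt_of_le_of_ne hM.trace_nonneg h2.symm
  have h4 : 0 < M.trace.re := (Complex.lt_def.mp h3).1
  exact pos_of_mul_pos_right (h4.trans_le h1) hc.le

/-- The inner sum of the fixed-point map, as a function of `V = Q ^ (1 - α)`. -/
noncomputable def auxG {n : ℕ} (S : Fin n → Matrix (Fin d) (Fin d) ℂ) (p : Fin n → ℝ)
    (V : Matrix (Fin d) (Fin d) ℂ) : Matrix (Fin d) (Fin d) ℂ :=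
  ∑ j, (p j / ((S j * V).trace).re) • S j

lemma auxG_posDef {n : ℕ} (hn : 0 < n) {S : Fin n → Matrix (Fin d) (Fin d) ℂ} {p : Fin n → ℝ}
    (hS : ∀ j, (S j).PosSemidef) (hS0 : ∀ j, S j ≠ 0) (hp : ∀ j, 0 < p j)
    (hPD : (∑ j, p j • S j).PosDef) {V : Matrix (Fin d) (Fin d) ℂ} (hV : V.PosDef) :
    (auxG S p V).PosDef := by
  have ht : ∀ j, 0 < ((S j * V).trace).re := fun j => aux_trace_pos (hS j) (hS0 j) hV
  set t : ℝ := ∑ j, ((S j * V).trace).re with htdef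
  have hle : ∀ j, ((S j * V).trace).re ≤ t := fun j =>
    Finset.single_le_sum (f := fun j => ((S j * V).trace).re) (fun i _ => (ht i).le)
      (Finset.mem_univ j)
  have htpos : 0 < t := (ht ⟨0, hn⟩).trans_le (hle _)
  rw [← Matrix.isStrictlyPositive_iff_posDef] at hPD ⊢
  refine (aux_smul_sp hPD (inv_pos.mpr htpos)).of_le ?_
  rw [Finset.smul_sum, auxG]
  refine Finset.sum_le_sum fun j _ => ?_
  rw [smul_smul]
  refine smul_le_smul_of_nonneg_right ?_ (Matrix.nonneg_iff_posSemidef.mpr (hS j))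
  rw [div_eq_inv_mul]
  exact mul_le_mul_of_nonneg_right (inv_anti₀ (ht j) (hle j)) (hp j).le

lemma auxG_close {n : ℕ} {S : Fin n → Matrix (Fin d) (Fin d) ℂ} {p : Fin n → ℝ}
    (hS : ∀ j, (S j).PosSemidef) (hS0 : ∀ j, S j ≠ 0) (hp : ∀ j, 0 < p j)
    {V U : Matrix (Fin d) (Fin d) ℂ} (hV : V.PosDef) (hU : U.PosDef) {r : ℝ}
    (h1 : Real.exp (-r) • V ≤ U) (h2 : U ≤ Real.exp r • V) :
    Real.exp (-r) • auxG S p V ≤ auxG S p U ∧ auxG S p U ≤ Real.exp r • auxG S p V := by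
  have tV : ∀ j, 0 < ((S j * V).trace).re := fun j => aux_trace_pos (hS j) (hS0 j) hV
  have tU : ∀ j, 0 < ((S j * U).trace).re := fun j => aux_trace_pos (hS j) (hS0 j) hU
  have e1 : ∀ j, Real.exp (-r) * ((S j * V).trace).re ≤ ((S j * U).trace).re := fun j => by
    have := aux_trace_mono (hS j) h1
    rwa [aux_trace_smul] at this
  have e2 : ∀ j, ((S j * U).trace).re ≤ Real.exp r * ((S j * V).trace).re := fun j => by
    have := aux_trace_mono (hS j) h2
    rwa [aux_trace_smul] at this
  have her : Real.exp (-r) * Real.exp r = 1 := by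
    rw [← Real.exp_add, neg_add_cancel, Real.exp_zero]
  rw [auxG, auxG, Finset.smul_sum, Finset.smul_sum]
  constructor
  · refine Finset.sum_le_sum fun j _ => ?_
    rw [smul_smul]
    refine smul_le_smul_of_nonneg_right ?_ (Matrix.nonneg_iff_posSemidef.mpr (hS j))
    rw [mul_div_assoc', div_le_div_iff₀ (tV j) (tU j)]
    have := mul_le_mul_of_nonneg_left (e2 j) (mul_pos (Real.exp_pos (-r)) (hp j)).le
    calc _ ≤ _ := this
      _ = (Real.exp (-r) * Real.exp r) * (p j * ((S j * V).trace).re) := by ring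
      _ = _ := by rw [her, one_mul]
  · refine Finset.sum_le_sum fun j _ => ?_
    rw [smul_smul]
    refine smul_le_smul_of_nonneg_right ?_ (Matrix.nonneg_iff_posSemidef.mpr (hS j))
    rw [mul_div_assoc', div_le_div_iff₀ (tU j) (tV j)]
    have := mul_le_mul_of_nonneg_left (e1 j) (mul_pos (Real.exp_pos r) (hp j)).le
    calc _ = (Real.exp (-r) * Real.exp r) * (p j * ((S j * V).trace).re) := by
          rw [her, one_mul]
      _ = _ := by ring
      _ ≤ _ := this

lemma aux_rpow_posDef {M : Matrix (Fin d) (Fin d) ℂ} (hM : M.PosDef) (r : ℝ) :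
    (matRpow M r).PosDef := by
  rw [aux_matRpow hM.posSemidef, ← Matrix.isStrictlyPositive_iff_posDef]
  exact (Matrix.isStrictlyPositive_iff_posDef.mpr hM).rpow M r

lemma aux_rpow_posSemidef {M : Matrix (Fin d) (Fin d) ℂ} (hM : M.PosSemidef) (r : ℝ) :
    (matRpow M r).PosSemidef := by
  rw [aux_matRpow hM, ← Matrix.nonneg_iff_posSemidef]
  exact CFC.rpow_nonneg

lemma aux_rpow_ne_zero {M : Matrix (Fin d) (Fin d) ℂ} (hM : M.PosSemidef) (hM0 : M ≠ 0) {α : ℝ}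
    (hα : 0 < α) : matRpow M α ≠ 0 := by
  rw [aux_matRpow hM]
  intro h
  have h0 := Matrix.nonneg_iff_posSemidef.mpr hM
  have h1 := CFC.rpow_rpow_of_exponent_nonneg M α α⁻¹ hα.le (inv_pos.mpr hα).le h0
  rw [mul_inv_cancel₀ hα.ne', CFC.rpow_one M h0, h] at h1
  exact hM0 (h1.symm.trans (CFC.zero_rpow (inv_pos.mpr hα).ne'))

/-- One step of the iteration contracts the Thompson closeness. -/
lemma aux_step {M N : Matrix (Fin d) (Fin d) ℂ} (hM : M.PosDef) (hN : N.PosDef) {α r : ℝ}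
    (hα : 1 / 2 < α) (h1 : Real.exp (-r) • M ≤ N) (h2 : N ≤ Real.exp r • M) :
    Real.exp (-(|1 - α| / α * r)) • matRpow (matRpow M (1 / α)) (1 - α) ≤
        matRpow (matRpow N (1 / α)) (1 - α) ∧
      matRpow (matRpow N (1 / α)) (1 - α) ≤
        Real.exp (|1 - α| / α * r) • matRpow (matRpow M (1 / α)) (1 - α) := by
  have hα0 : 0 < α := by linarith
  have hM' := Matrix.isStrictlyPositive_iff_posDef.mpr hM
  have hN' := Matrix.isStrictlyPositive_iff_posDef.mpr hN
  rw [aux_matRpow (aux_rpow_posDef hM _).posSemidef, aux_matRpow (aux_rpow_posDef hN _).posSemidef,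
    aux_matRpow hM.posSemidef, aux_matRpow hN.posSemidef,
    CFC.rpow_rpow M _ _ (by positivity) hM', CFC.rpow_rpow N _ _ (by positivity) hN']
  have hs : |1 - α| / α = |1 / α * (1 - α)| := by
    rw [abs_mul, abs_of_pos (by positivity : 0 < 1 / α)]; ring
  rw [hs]
  refine aux_one_side hN' hM' ?_ h1 h2
  rw [← hs, div_le_one hα0, abs_le]
  constructor <;> linarith

lemma aux_main {n : ℕ} (hn : 0 < n) {α : ℝ} (hα : 1 / 2 < α) (hα1 : α ≠ 1)
    (W : Fin n → Matrix (Fin d) (Fin d) ℂ)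
    (hW : ∀ j, (W j).PosSemidef ∧ (W j).trace = 1)
    (p : Fin n → ℝ) (hppos : ∀ j, 0 < p j)
    (hPD : (∑ j, p j • matRpow (W j) α).PosDef)
    (Qstar : Matrix (Fin d) (Fin d) ℂ) (hQstar : Qstar.PosDef)
    (hfix : augFixedPointMap α W p Qstar = Qstar)
    (Q : ℕ → Matrix (Fin d) (Fin d) ℂ) (hQ1 : (Q 1).PosDef)
    (hiter : ∀ t, 1 ≤ t → Q (t + 1) = augFixedPointMap α W p (Q t))
    (T : ℕ) (j : Fin n) :
    |petzRenyiDiv α (W j) (Q (T + 1)) - petzRenyiDiv α (W j) Qstar|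
      ≤ (1 / |1 - α|) * (|1 - α| / α) ^ T
          * thompsonDist (matRpow (Q 1) (1 - α)) (matRpow Qstar (1 - α)) := by
  have hα0 : 0 < α := by linarith
  have hS : ∀ j, (matRpow (W j) α).PosSemidef := fun j => aux_rpow_posSemidef (hW j).1 α
  have hS0 : ∀ j, matRpow (W j) α ≠ 0 := fun j => by
    refine aux_rpow_ne_zero (hW j).1 ?_ hα0
    intro h
    have := (hW j).2
    rw [h, Matrix.trace_zero] at this
    exact zero_ne_one this
  have hF : ∀ X, augFixedPointMap α W p X =
      matRpow (auxG (fun j => matRpow (W j) α) p (matRpow X (1 - α))) (1 / α) := fun X => rfl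
  have hG : ∀ X : Matrix (Fin d) (Fin d) ℂ, X.PosDef →
      (auxG (fun j => matRpow (W j) α) p (matRpow X (1 - α))).PosDef := fun X hX =>
    auxG_posDef hn hS hS0 hppos hPD (aux_rpow_posDef hX _)
  have hQ : ∀ t, (Q (t + 1)).PosDef := by
    intro t
    induction t with
    | zero => exact hQ1
    | succ k ih =>
      rw [hiter (k + 1) (by omega), hF]
      exact aux_rpow_posDef (hG _ ih) _
  have hγ : 0 < |1 - α| := abs_pos.mpr (sub_ne_zero.mpr hα1.symm)
  have hclose : ∀ r : ℝ,
      Real.exp (-r) • matRpow (Q 1) (1 - α) ≤ matRpow Qstar (1 - α) →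
      matRpow Qstar (1 - α) ≤ Real.exp r • matRpow (Q 1) (1 - α) → ∀ t : ℕ,
      Real.exp (-((|1 - α| / α) ^ t * r)) • matRpow (Q (t + 1)) (1 - α) ≤ matRpow Qstar (1 - α) ∧
      matRpow Qstar (1 - α) ≤
        Real.exp ((|1 - α| / α) ^ t * r) • matRpow (Q (t + 1)) (1 - α) := by
    intro r h1 h2 t
    induction t with
    | zero => simpa using ⟨h1, h2⟩
    | succ k ih =>
      have h3 := auxG_close hS hS0 hppos (aux_rpow_posDef (hQ k) _) (aux_rpow_posDef hQstar _)
        ih.1 ih.2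
      have h4 := aux_step (hG _ (hQ k)) (hG _ hQstar) hα h3.1 h3.2
      rw [← hF, ← hF, hfix, ← hiter (k + 1) (by omega), ← mul_assoc, ← pow_succ'] at h4
      exact h4
  have hbound : ∀ r : ℝ,
      Real.exp (-r) • matRpow (Q 1) (1 - α) ≤ matRpow Qstar (1 - α) →
      matRpow Qstar (1 - α) ≤ Real.exp r • matRpow (Q 1) (1 - α) →
      |petzRenyiDiv α (W j) (Q (T + 1)) - petzRenyiDiv α (W j) Qstar|
        ≤ (1 / |1 - α|) * (|1 - α| / α) ^ T * r := by
    intro r h1 h2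
    obtain ⟨k1, k2⟩ := hclose r h1 h2 T
    have t1 := aux_trace_mono (hS j) k1
    have t2 := aux_trace_mono (hS j) k2
    rw [aux_trace_smul] at t1 t2
    have pQ := aux_trace_pos (hS j) (hS0 j) (aux_rpow_posDef (hQ T) (1 - α))
    have pS := aux_trace_pos (hS j) (hS0 j) (aux_rpow_posDef hQstar (1 - α))
    have l1 := Real.log_le_log (mul_pos (Real.exp_pos _) pQ) t1
    have l2 := Real.log_le_log pS t2
    rw [Real.log_mul (Real.exp_pos _).ne' pQ.ne', Real.log_exp] at l1 l2
    rw [petzRenyiDiv, petzRenyiDiv, ← mul_sub, abs_mul, abs_div, abs_one, abs_sub_comm α 1,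
      mul_assoc]
    refine mul_le_mul_of_nonneg_left ?_ (by positivity)
    rw [abs_le]
    constructor <;> linarith
  have hc : 0 < (1 / |1 - α|) * (|1 - α| / α) ^ T := by positivity
  rw [mul_comm, ← div_le_iff₀ hc, thompsonDist]
  refine le_csInf ?_ ?_
  · obtain ⟨r, hr⟩ := aux_nonempty
      (Matrix.isStrictlyPositive_iff_posDef.mpr (aux_rpow_posDef hQ1 (1 - α)))
      (Matrix.isStrictlyPositive_iff_posDef.mpr (aux_rpow_posDef hQstar (1 - α)))
    exact ⟨r, hr⟩
  · rintro r ⟨-, h1, h2⟩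
    rw [div_le_iff₀ hc, mul_comm]
    exact hbound r h1 h2

end AuxMatrix

/-- convergence of the gradient estimates: the Petz–Rényi divergences with
respect to the iterates converge linearly to those with respect to the fixed point. -/
theorem aug_divergence_convergence {n d : ℕ} (hn : 0 < n) (hd : 0 < d) (α : ℝ)
    (hα : α ∈ Set.Ioo (1 / 2 : ℝ) 1 ∪ Set.Ioi (1 : ℝ))
    (W : Fin n → Matrix (Fin d) (Fin d) ℂ)
    (hW : ∀ j, (W j).PosSemidef ∧ (W j).trace = 1)
    (p : Fin n → ℝ) (hp : p ∈ stdSimplex ℝ (Fin n)) (hppos : ∀ j, 0 < p j)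
    (hPD : (∑ j, p j • matRpow (W j) α).PosDef)
    (Qstar : Matrix (Fin d) (Fin d) ℂ) (hQstar : Qstar.PosDef)
    (hfix : augFixedPointMap α W p Qstar = Qstar)
    (Q : ℕ → Matrix (Fin d) (Fin d) ℂ) (hQ1 : (Q 1).PosDef)
    (hiter : ∀ t, 1 ≤ t → Q (t + 1) = augFixedPointMap α W p (Q t))
    (T : ℕ) (hT : 1 ≤ T) (j : Fin n) :
    |petzRenyiDiv α (W j) (Q (T + 1)) - petzRenyiDiv α (W j) Qstar|
      ≤ (1 / |1 - α|) * (|1 - α| / α) ^ T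
          * thompsonDist (matRpow (Q 1) (1 - α)) (matRpow Qstar (1 - α)) := by
  rcases hα with h | h
  · exact aux_main hn h.1 h.2.ne W hW p hppos hPD Qstar hQstar hfix Q hQ1 hiter T j
  · have h' : 1 < α := h
    exact aux_main hn (by linarith) h'.ne' W hW p hppos hPD Qstar hQstar hfix Q hQ1 hiter T j
end
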